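/- Let n ≥ 2 be an integer. There exists a polynomial P ∈ ℚ[X] whose degree is exactly ⌊n/2⌋ − 1 and whose leading coefficient is the Catalan number C_{n−1} = (2n−2)!/(n!·(n−1)!), such that for every integer d ≥ n and all 𝔪, 𝔫 ∈ M(2n) with loop(𝔪,𝔫) = 1 (i.e., 𝔪⁻¹𝔫 has coset type the one-part partition (n)), the inverse Gram matrix entry satisfies (G_n^{O(d)})⁻¹(𝔪,𝔫) = (−1)^{n−1} · P(d) / ( d · ∏_{j=1}^{n−1} (d+2j)(d−j) · ∏_{k=1}^{⌊n/2⌋−1} (d+2k−1) ). -/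

import Mathlib

/-- A pair partition of `{1,…,N}` identified with a fixed-point-free involution of `Fin N`. -/
def IsPairMatching {N : ℕ} (m : Equiv.Perm (Fin N)) : Prop :=
  (∀ x, m (m x) = x) ∧ (∀ x, m x ≠ x)

instance {N : ℕ} : DecidablePred (IsPairMatching (N := N)) := fun _ => by
  unfold IsPairMatching; infer_instance

/-- `Matchings N` is the set `M(N)` of pair partitions (fixed-point-free involutions). -/
def Matchings (N : ℕ) : Type := {m : Equiv.Perm (Fin N) // IsPairMatching m}

instance (N : ℕ) : Fintype (Matchings N) := Subtype.fintype _
instance (N : ℕ) : DecidableEq (Matchings N) := Subtype.instDecidableEq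

/-- number of orbits (cycles together with fixed points) of a permutation of `Fin N`. -/
def cycleCount {N : ℕ} (σ : Equiv.Perm (Fin N)) : ℕ :=
  σ.cycleType.card + (Finset.univ.filter fun x => σ x = x).card

/-- `loop(𝔪,𝔫)`: half the number of orbits of `𝔪 ∘ 𝔫`. -/
def loopCount {N : ℕ} (m p : Matchings N) : ℕ := cycleCount (m.1 * p.1) / 2

/-- The orthogonal Gram matrix `G_n^{O(d)}`. -/
noncomputable def GramO (d n : ℕ) : Matrix (Matchings (2*n)) (Matchings (2*n)) ℝ :=
  fun m p => (d : ℝ) ^ loopCount m p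

/-- Occupation number at site `y` of the Maya diagram of the first `r` contents of `c`. -/
def mayaProfile (c : ℕ → ℤ) (r : ℕ) (y : ℤ) : ℤ :=
  (if 0 ≤ y then 1 else 0) + ((Finset.range r).filter fun p => c p = y + 1).card
    - ((Finset.range r).filter fun p => c p = y).card

theorem mayaProfile_zero (c : ℕ → ℤ) (y : ℤ) :
    mayaProfile c 0 y = if 0 ≤ y then 1 else 0 := by
  simp [mayaProfile]

theorem mayaProfile_succ (c : ℕ → ℤ) (r : ℕ) (y : ℤ) :
    mayaProfile c (r + 1) y =
      mayaProfile c r y + (if c r = y + 1 then 1 else 0) - (if c r = y then 1 else 0) := by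
  simp only [mayaProfile, Finset.range_add_one, Finset.filter_insert]
  by_cases h1 : c r = y + 1 <;> by_cases h2 : c r = y <;> simp [h1, h2] <;> ring

theorem mayaProfile_congr {c c' : ℕ → ℤ} {r : ℕ} (h : ∀ p < r, c p = c' p) (y : ℤ) :
    mayaProfile c r y = mayaProfile c' r y := by
  induction r with
  | zero => simp [mayaProfile_zero]
  | succ r ih =>
    rw [mayaProfile_succ, mayaProfile_succ, ih fun p hp => h p (by omega), h r (by omega)]

theorem comp_swap_left (c : ℕ → ℤ) (i : ℕ) : (c ∘ Equiv.swap i (i + 1)) i = c (i + 1) := by simp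

theorem comp_swap_right (c : ℕ → ℤ) (i : ℕ) : (c ∘ Equiv.swap i (i + 1)) (i + 1) = c i := by simp

theorem comp_swap_of_ne (c : ℕ → ℤ) {i p : ℕ} (h : p ≠ i) (hp : p ≠ i + 1) :
    (c ∘ Equiv.swap i (i + 1)) p = c p := by
  simp [Equiv.swap_apply_of_ne_of_ne h hp]

/-- Closure properties of the set of content vectors of joint eigenvectors of Jucys–Murphy
elements. -/
structure IsContentSet (N : ℕ) (S : Set (ℕ → ℤ)) : Prop where
  zero : ∀ c ∈ S, 0 < N → c 0 = 0
  ne : ∀ c ∈ S, ∀ i, i + 1 < N → c i ≠ c (i + 1)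
  swap : ∀ c ∈ S, ∀ i, i + 1 < N → c (i + 1) ≠ c i + 1 → c (i + 1) ≠ c i - 1 →
    c ∘ Equiv.swap i (i + 1) ∈ S
  braid : ∀ c ∈ S, ∀ i, i + 2 < N → c (i + 2) = c i →
    c (i + 1) ≠ c i + 1 ∧ c (i + 1) ≠ c i - 1

/-- The `q`-th entry of `c` is the content of an addable box. -/
def MayaStep (c : ℕ → ℤ) (q : ℕ) : Prop :=
  mayaProfile c q (c q) = 1 ∧ mayaProfile c q (c q - 1) = 0

theorem mayaProfile_zero_or_one {c : ℕ → ℤ} {r : ℕ} (h : ∀ q < r, MayaStep c q) (y : ℤ) :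
    mayaProfile c r y = 0 ∨ mayaProfile c r y = 1 := by
  induction r with
  | zero => rw [mayaProfile_zero]; split_ifs <;> simp
  | succ r ih =>
    have h1 := h r (by omega)
    have h2 := ih fun q hq => h q (by omega)
    rw [mayaProfile_succ]
    by_cases e1 : c r = y
    · subst e1
      have := h1.1
      simp [this]
    · by_cases e2 : c r = y + 1
      · have h3 := h1.2
        rw [e2] at h3
        simp at h3
        simp [e2, h3]
      · simpa [e1, e2] using h2

/-- A removable box may be moved to the last position. -/
theorem IsContentSet.exists_removable_last {N : ℕ} {S : Set (ℕ → ℤ)} (hS : IsContentSet N S)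
    {r : ℕ} (hr : r < N) (h : ∀ c ∈ S, ∀ q < r, MayaStep c q) {c : ℕ → ℤ} (hc : c ∈ S) {x : ℤ}
    (h1 : mayaProfile c r (x - 1) = 1) (h0 : mayaProfile c r x = 0) :
    ∃ t, r = t + 1 ∧ ∃ c' ∈ S, c' t = x ∧ ∀ p ≥ r, c' p = c p := by
  induction r with
  | zero =>
    rw [mayaProfile_zero] at h1 h0
    split_ifs at h1 h0 <;> omega
  | succ r ih =>
    refine ⟨r, rfl, ?_⟩
    by_cases e : c r = x
    · exact ⟨c, hc, e, fun _ _ => rfl⟩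
    have hm := h c hc r (by omega)
    rw [mayaProfile_succ] at h1 h0
    have e1 : c r ≠ x - 1 := fun e1 => by
      have := hm.1
      rw [e1] at this h1
      simp [this] at h1
    have e2 : c r ≠ x + 1 := fun e2 => by
      have := hm.2
      rw [e2] at this h0
      simp at this
      simp [this] at h0
    simp only [sub_add_cancel, e, e1, e2, if_false, add_zero, sub_zero] at h1 h0
    obtain ⟨t, rfl, c', hc', ht, hp⟩ := ih (by omega) (fun c hc q hq => h c hc q (by omega)) h1 h0
    have hy := hp (t + 1) le_rfl
    refine ⟨_, hS.swap c' hc' t (by omega) ?_ ?_, ?_, fun p hp' => ?_⟩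
    · rw [ht, hy]; exact e2
    · rw [ht, hy]; exact e1
    · rw [comp_swap_right, ht]
    · rw [comp_swap_of_ne _ (by omega) (by omega), hp p (by omega)]

theorem IsContentSet.mayaStep {N : ℕ} {S : Set (ℕ → ℤ)} (hS : IsContentSet N S) (q : ℕ)
    (hq : q < N) : ∀ c ∈ S, MayaStep c q := by
  induction q using Nat.strong_induction_on with
  | _ q ih =>
  intro c hc
  rcases q with _ | r
  · simp [MayaStep, hS.zero c hc hq, mayaProfile_zero]
  have hm := ih r (by omega) (by omega) c hc
  have hne := hS.ne c hc r hq
  have hprev : ∀ c ∈ S, ∀ q < r, MayaStep c q := fun c hc q hq' =>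
    ih q (by omega) (by omega) c hc
  have hno : ∀ x, c (r + 1) = x → mayaProfile c r (x - 1) = 1 → mayaProfile c r x = 0 →
      c r = x - 1 ∨ c r = x + 1 → False := by
    intro x hx h1 h0 hy
    obtain ⟨t, rfl, c', hc', ht, hp⟩ := hS.exists_removable_last (by omega) hprev hc h1 h0
    have a1 := hp (t + 1) le_rfl
    have a2 := hp (t + 2) (by omega)
    have := hS.braid c' hc' t (by omega) (by rw [a2, ht, hx])
    rw [a1, ht] at this
    omega
  generalize hx : c (r + 1) = x at *
  by_cases e1 : c r = x - 1
  · have h1 := hm.1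
    rw [e1] at h1
    have h2 : mayaProfile c r x = 1 := by
      rcases mayaProfile_zero_or_one (hprev c hc) x with h | h
      · exact (hno x rfl h1 h (Or.inl e1)).elim
      · exact h
    refine ⟨?_, ?_⟩ <;> rw [hx, mayaProfile_succ, e1] <;> simp [h1, h2]
    omega
  by_cases e2 : c r = x + 1
  · have h1 := hm.2
    rw [e2] at h1
    simp only [add_sub_cancel_right] at h1
    have h2 : mayaProfile c r (x - 1) = 0 := by
      rcases mayaProfile_zero_or_one (hprev c hc) (x - 1) with h | h
      · exact h
      · exact (hno x rfl h h1 (Or.inr e2)).elim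
    refine ⟨?_, ?_⟩ <;> rw [hx, mayaProfile_succ, e2] <;> simp [h1, h2]
    omega
  have hs := hS.swap c hc r hq (by omega) (by omega)
  have hcong := mayaProfile_congr (c := c ∘ Equiv.swap r (r + 1)) (c' := c) (r := r)
    fun p hp => comp_swap_of_ne _ (by omega) (by omega)
  have := ih r (by omega) (by omega) _ hs
  unfold MayaStep at this
  rw [comp_swap_left, hx, hcong, hcong] at this
  refine ⟨?_, ?_⟩ <;> rw [hx, mayaProfile_succ] <;> simp [e1, e2, hne, this]

/-- Multiplicity of `y` among the first `k` entries of `x`. -/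
def countBelow (x : ℕ → ℤ) (k : ℕ) (y : ℤ) : ℤ := ((Finset.range k).filter fun p => x p = y).card

theorem countBelow_zero (x : ℕ → ℤ) (y : ℤ) : countBelow x 0 y = 0 := by simp [countBelow]

theorem countBelow_succ (x : ℕ → ℤ) (k : ℕ) (y : ℤ) :
    countBelow x (k + 1) y = countBelow x k y + if x k = y then 1 else 0 := by
  simp only [countBelow, Finset.range_add_one, Finset.filter_insert]
  by_cases h2 : x k = y <;> simp [h2]

theorem mayaProfile_doubled {c : ℕ → ℤ} {k : ℕ} (hd : ∀ j < k, c (2 * j + 1) = c (2 * j) + 1)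
    (y : ℤ) : mayaProfile c (2 * k) y =
      (if 0 ≤ y then 1 else 0) + countBelow (fun j => c (2 * j)) k (y + 1)
        - countBelow (fun j => c (2 * j)) k (y - 1) := by
  induction k with
  | zero => simp [mayaProfile_zero, countBelow_zero]
  | succ k ih =>
    rw [show 2 * (k + 1) = 2 * k + 1 + 1 by ring, mayaProfile_succ, mayaProfile_succ,
      ih fun j hj => hd j (by omega), countBelow_succ, countBelow_succ, hd k (by omega)]
    have e1 : (c (2 * k) + 1 = y + 1) = (c (2 * k) = y) := by simp
    have e2 : (c (2 * k) + 1 = y) = (c (2 * k) = y - 1) := by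
      apply propext; constructor <;> intro h <;> linarith
    simp only [e1, e2]
    ring

/-- A doubled content sequence: the sequence of contents along a growth of Young diagrams with even
rows, where boxes are added in horizontal pairs. -/
structure IsDoubled (n : ℕ) (c : ℕ → ℤ) : Prop where
  step : ∀ q < 2 * n, MayaStep c q
  double : ∀ k < n, c (2 * k + 1) = c (2 * k) + 1

namespace IsDoubled

variable {n : ℕ} {c : ℕ → ℤ}

theorem conditions (h : IsDoubled n c) {k : ℕ} (hk : k < n) :
    let x := c (2 * k)
    let m := countBelow (fun j => c (2 * j)) k
    (if 0 ≤ x then (1 : ℤ) else 0) + m (x + 1) - m (x - 1) = 1 ∧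
    (if 1 ≤ x then (1 : ℤ) else 0) + m x - m (x - 2) = 0 ∧
    (if -1 ≤ x then (1 : ℤ) else 0) + m (x + 2) - m x = 1 := by
  intro x m
  have hd : ∀ j < k, c (2 * j + 1) = c (2 * j) + 1 := fun j hj => h.double j (by omega)
  have h1 := h.step (2 * k) (by omega)
  have h2 := (h.step (2 * k + 1) (by omega)).1
  rw [h.double k hk, mayaProfile_succ, mayaProfile_doubled hd] at h2
  unfold MayaStep at h1
  rw [mayaProfile_doubled hd, mayaProfile_doubled hd] at h1
  refine ⟨h1.1, ?_, ?_⟩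
  · have := h1.2
    simp only [sub_add_cancel, sub_sub, one_add_one_eq_two, sub_nonneg] at this
    exact this
  · simp only [add_assoc, one_add_one_eq_two, add_sub_cancel_right] at h2
    have e : (0 ≤ c (2 * k) + 1) = (-1 ≤ x) := by
      apply propext; constructor <;> intro h <;> linarith
    simpa [e] using h2

theorem neg_le (h : IsDoubled n c) {k : ℕ} (hk : k < n) : -(k : ℤ) ≤ c (2 * k) := by
  induction k using Nat.strong_induction_on with
  | _ k ih =>
  by_contra! hlt
  have h1 := (h.conditions hk).1
  rw [if_neg (by omega)] at h1
  have h2 : 0 ≤ countBelow (fun j => c (2 * j)) k (c (2 * k) - 1) := by simp [countBelow]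
  have h3 : 0 < countBelow (fun j => c (2 * j)) k (c (2 * k) + 1) := by omega
  simp only [countBelow, Nat.cast_pos, Finset.card_pos] at h3
  obtain ⟨j, hj⟩ := h3
  simp only [Finset.mem_filter, Finset.mem_range] at hj
  have := ih j hj.1 (by omega)
  omega

/-- Contents of the left halves of the dominoes in a diagram with rows `2a`, `2b`, followed by `l`
rows of length `2`. -/
def hookSet (a b l : ℕ) (y : ℤ) : Prop :=
  (0 ≤ y ∧ y < 2 * a ∧ y % 2 = 0) ∨ (-1 ≤ y ∧ y ≤ 2 * b - 3 ∧ y % 2 = 1) ∨ (-(l + 1) ≤ y ∧ y ≤ -2)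

theorem exists_hook (h : IsDoubled n c) (h0 : ∀ k, 0 < k → k < n → c (2 * k) ≠ 0) {k : ℕ}
    (hk0 : 0 < k) (hk : k ≤ n) : ∃ a b l : ℕ, k = a + b + l ∧ b ≤ a ∧ (b = 0 → l = 0) ∧ 0 < a ∧
      ∀ y, (countBelow (fun j => c (2 * j)) k y = 1 ∧ hookSet a b l y) ∨
        (countBelow (fun j => c (2 * j)) k y = 0 ∧ ¬ hookSet a b l y) := by
  induction k, hk0 using Nat.le_induction with
  | base =>
    have hc : c 0 = 0 := by
      have := h.conditions (k := 0) (by omega)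
      simp only [countBelow_zero, mul_zero] at this
      split_ifs at this <;> omega
    refine ⟨1, 0, 0, rfl, by omega, by simp, by omega, fun y => ?_⟩
    rw [countBelow_succ, countBelow_zero]
    simp only [mul_zero, hc, hookSet]
    split_ifs <;> omega
  | succ k hk0 ih =>
    obtain ⟨a, b, l, hk', hba, hbl, ha, hm⟩ := ih (by omega)
    have hne := h0 k (by omega) (by omega)
    obtain ⟨C1, C2, C3⟩ := h.conditions (k := k) (by omega)
    have hs : ∀ y, countBelow (fun j => c (2 * j)) (k + 1) y = _ := countBelow_succ _ k
    generalize c (2 * k) = x at *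
    generalize countBelow (fun j => c (2 * j)) k = m at *
    have m1 := hm (x + 1)
    have m2 := hm (x - 1)
    have m3 := hm x
    have m4 := hm (x - 2)
    have m5 := hm (x + 2)
    unfold hookSet at *
    have key : x = 2 * a ∨ (x = 2 * b - 1 ∧ b < a) ∨ (x = -(l + 2) ∧ 0 < b) := by
      clear hs hm ih
      rcases lt_trichotomy x 0 with hx | hx | hx
      · rw [if_neg (by omega)] at C1 C2
        rcases m1 with ⟨e1, m1⟩ | ⟨e1, -⟩
        · rcases m2 with ⟨e2, -⟩ | ⟨e2, m2⟩
          · exfalso; linarith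
          · rcases m3 with ⟨e3, -⟩ | ⟨e3, m3⟩
            · rcases m4 with ⟨-, m4⟩ | ⟨e4, -⟩
              · clear C1 C2 C3 m5
                omega
              · exfalso; linarith
            · clear C1 C2 C3 m4 m5
              omega
        · exfalso
          rcases m2 with ⟨e2, -⟩ | ⟨e2, -⟩ <;> linarith
      · exact absurd hx hne
      · rw [if_pos (by omega)] at C1 C2 C3
        rcases m3 with ⟨e3, m3⟩ | ⟨e3, m3⟩
        · exfalso
          rcases m4 with ⟨e4, -⟩ | ⟨e4, -⟩ <;> linarith
        · have e4 : m (x - 2) = 1 := by linarith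
          rcases m4 with ⟨-, m4⟩ | ⟨e4', -⟩
          · rcases m1 with ⟨e1, m1⟩ | ⟨e1, m1⟩
            · rcases m2 with ⟨e2, m2⟩ | ⟨e2, m2⟩
              · clear C1 C2 C3 m5
                omega
              · exfalso; linarith
            · rcases m2 with ⟨e2, m2⟩ | ⟨e2, m2⟩
              · exfalso; linarith
              · clear C1 C2 C3 m5
                omega
          · exfalso; linarith
    rcases key with hx | ⟨hx, hb⟩ | ⟨hx, hb⟩
    · refine ⟨a + 1, b, l, by omega, by omega, hbl, by omega, fun y => ?_⟩
      rw [hs]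
      have := hm y
      push_cast
      split_ifs <;> omega
    · refine ⟨a, b + 1, l, by omega, by omega, by omega, by omega, fun y => ?_⟩
      rw [hs]
      have := hm y
      push_cast
      split_ifs <;> omega
    · refine ⟨a, b, l + 1, by omega, by omega, by omega, by omega, fun y => ?_⟩
      rw [hs]
      have := hm y
      push_cast
      split_ifs <;> omega

end IsDoubled

/-- The nonzero poles (up to sign) of the one-cycle orthogonal Weingarten function. -/
def poleSet (n : ℕ) : Finset ℤ :=
  (Finset.Icc 1 (n - 1)).image (fun j : ℕ => (2 * j : ℤ)) ∪
    (Finset.Icc 1 (n - 1)).image (fun j : ℕ => (-j : ℤ)) ∪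
    (Finset.Icc 1 (n / 2 - 1)).image (fun j : ℕ => (2 * j - 1 : ℤ))

theorem mem_poleSet {n : ℕ} {y : ℤ} : y ∈ poleSet n ↔
    (0 < y ∧ y ≤ 2 * (n - 1) ∧ y % 2 = 0) ∨ (-(n - 1) ≤ y ∧ y ≤ -1) ∨
      (1 ≤ y ∧ y ≤ 2 * (n / 2 : ℕ) - 3 ∧ y % 2 = 1) := by
  simp only [poleSet, Finset.mem_union, Finset.mem_image, Finset.mem_Icc, or_assoc]
  refine or_congr ?_ (or_congr ?_ ?_)
  · constructor
    · rintro ⟨j, hj, rfl⟩; omega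
    · intro h; exact ⟨(y / 2).toNat, by omega, by omega⟩
  · constructor
    · rintro ⟨j, hj, rfl⟩; omega
    · intro h; exact ⟨(-y).toNat, by omega, by omega⟩
  · constructor
    · rintro ⟨j, hj, rfl⟩; omega
    · intro h; exact ⟨((y + 1) / 2).toNat, by omega, by omega⟩

theorem prod_poleSet {R : Type*} [CommRing R] (n : ℕ) (t : R) :
    ∏ y ∈ poleSet n, (t + (y : R)) =
      (∏ j ∈ Finset.Icc 1 (n - 1), (t + 2 * (j : R)) * (t - (j : R))) *
        ∏ k ∈ Finset.Icc 1 (n / 2 - 1), (t + 2 * (k : R) - 1) := by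
  unfold poleSet
  rw [Finset.prod_union, Finset.prod_union, Finset.prod_image, Finset.prod_image,
    Finset.prod_image, Finset.prod_mul_distrib]
  · congr 1
    · congr 1 <;> refine Finset.prod_congr rfl fun j _ => ?_ <;> push_cast <;> ring
    · refine Finset.prod_congr rfl fun j _ => ?_
      push_cast; ring
  any_goals intro a _ b _ hab; simp only at hab; omega
  · rw [Finset.disjoint_left]
    simp only [Finset.mem_image, Finset.mem_Icc]
    rintro _ ⟨a, ha, rfl⟩ ⟨b, hb, hab⟩
    omega
  · rw [Finset.disjoint_left]
    simp only [Finset.mem_union, Finset.mem_image, Finset.mem_Icc]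
    rintro _ (⟨a, ha, rfl⟩ | ⟨a, ha, rfl⟩) ⟨b, hb, hab⟩ <;> omega

theorem card_poleSet (n : ℕ) : (poleSet n).card = (n - 1) + (n - 1) + (n / 2 - 1) := by
  unfold poleSet
  rw [Finset.card_union_of_disjoint, Finset.card_union_of_disjoint, Finset.card_image_of_injOn,
    Finset.card_image_of_injOn, Finset.card_image_of_injOn]
  · simp
  any_goals intro a _ b _ hab; simp only at hab; omega
  · rw [Finset.disjoint_left]
    simp only [Finset.mem_image, Finset.mem_Icc]
    rintro _ ⟨a, ha, rfl⟩ ⟨b, hb, hab⟩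
    omega
  · rw [Finset.disjoint_left]
    simp only [Finset.mem_union, Finset.mem_image, Finset.mem_Icc]
    rintro _ (⟨a, ha, rfl⟩ | ⟨a, ha, rfl⟩) ⟨b, hb, hab⟩ <;> omega

namespace IsDoubled

variable {n : ℕ} {c : ℕ → ℤ}

theorem injOn (h : IsDoubled n c) (hn : 0 < n) (h0 : ∀ k, 0 < k → k < n → c (2 * k) ≠ 0) :
    Set.InjOn (fun k => c (2 * k)) (Finset.range n) := by
  obtain ⟨a, b, l, -, -, -, -, hm⟩ := h.exists_hook h0 hn le_rfl
  intro i hi j hj hij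
  have : ((Finset.range n).filter fun p => c (2 * p) = c (2 * i)).card ≤ 1 := by
    have := hm (c (2 * i))
    simp only [countBelow] at this
    omega
  exact Finset.card_le_one.1 this i (by simpa using hi) j (by simpa [hij.symm] using hj)

theorem mem_poleSet (h : IsDoubled n c) (h0 : ∀ k, 0 < k → k < n → c (2 * k) ≠ 0) {k : ℕ}
    (hk0 : 0 < k) (hk : k < n) : c (2 * k) ∈ poleSet n := by
  obtain ⟨a, b, l, h1, h2, h3, h4, hm⟩ := h.exists_hook h0 (by omega : 0 < n) le_rfl
  have hpos : 0 < ((Finset.range n).filter fun p => c (2 * p) = c (2 * k)).card :=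
    Finset.card_pos.2 ⟨k, by simpa using hk⟩
  have hne := h0 k hk0 hk
  have := hm (c (2 * k))
  simp only [countBelow, hookSet] at this
  rw [_root_.mem_poleSet]
  rcases this with ⟨-, this⟩ | ⟨this, -⟩
  · generalize c (2 * k) = x at *
    clear hm
    rcases Nat.eq_zero_or_pos b with hb | hb
    · have := h3 hb
      omega
    · omega
  · omega

theorem prod_sdiff {R : Type*} [CommRing R] (h : IsDoubled n c)
    (h0 : ∀ k, 0 < k → k < n → c (2 * k) ≠ 0) (t : R) :
    (∏ y ∈ poleSet n \ (Finset.Ico 1 n).image fun k => c (2 * k), (t + (y : R))) *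
      ∏ k ∈ Finset.Ico 1 n, (t + (c (2 * k) : R)) = ∏ y ∈ poleSet n, (t + (y : R)) := by
  rw [← Finset.prod_sdiff (s₁ := (Finset.Ico 1 n).image fun k => c (2 * k)) (s₂ := poleSet n),
    Finset.prod_image]
  · intro i hi j hj hij
    simp only [Finset.coe_Ico, Set.mem_Ico] at hi hj
    exact h.injOn (by omega) h0 (by simpa using hi.2) (by simpa using hj.2) hij
  · intro y hy
    simp only [Finset.mem_image, Finset.mem_Ico] at hy
    obtain ⟨k, hk, rfl⟩ := hy
    exact h.mem_poleSet h0 hk.1 hk.2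

end IsDoubled

section Blocks

open Finset

variable {N : ℕ}

/-- `S` is a union of cycles of the union of the two matchings. -/
def IsStable (m p : Matchings N) (S : Finset (Fin N)) : Prop := ∀ x ∈ S, m.1 x ∈ S ∧ p.1 x ∈ S

open Classical in
/-- The cycle through `x` of the union of the two matchings. -/
noncomputable def block (m p : Matchings N) (x : Fin N) : Finset (Fin N) :=
  univ.filter fun y => ∀ S, IsStable m p S → x ∈ S → y ∈ S

theorem Matchings.apply_apply (m : Matchings N) (x : Fin N) : m.1 (m.1 x) = x := m.2.1 x

theorem Matchings.apply_ne (m : Matchings N) (x : Fin N) : m.1 x ≠ x := m.2.2 x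

theorem Matchings.inv_eq (m : Matchings N) : (m.1)⁻¹ = m.1 := by
  ext x; rw [Equiv.Perm.inv_eq_iff_eq.2 (m.apply_apply x).symm]

variable {m p : Matchings N} {x y : Fin N} {S T : Finset (Fin N)}

theorem mem_block_self : x ∈ block m p x := by simp [block]

theorem block_subset (hS : IsStable m p S) (hx : x ∈ S) : block m p x ⊆ S := by
  intro y hy
  simp only [block, mem_filter, mem_univ, true_and] at hy
  exact hy S hS hx

theorem isStable_block : IsStable m p (block m p x) := by
  intro y hy
  simp only [block, mem_filter, mem_univ, true_and] at hy ⊢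
  exact ⟨fun S hS hx => (hS _ (hy S hS hx)).1, fun S hS hx => (hS _ (hy S hS hx)).2⟩

theorem IsStable.compl (hS : IsStable m p S) : IsStable m p Sᶜ := by
  intro y hy
  simp only [mem_compl] at hy ⊢
  refine ⟨fun h => hy ?_, fun h => hy ?_⟩
  · simpa [m.apply_apply] using (hS _ h).1
  · simpa [p.apply_apply] using (hS _ h).2

theorem IsStable.union (hS : IsStable m p S) (hT : IsStable m p T) : IsStable m p (S ∪ T) := by
  intro y hy
  rcases mem_union.1 hy with h | h
  · exact ⟨mem_union_left _ (hS y h).1, mem_union_left _ (hS y h).2⟩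
  · exact ⟨mem_union_right _ (hT y h).1, mem_union_right _ (hT y h).2⟩

theorem block_eq_of_mem (h : y ∈ block m p x) : block m p y = block m p x := by
  refine (block_subset isStable_block h).antisymm (block_subset isStable_block ?_)
  by_contra hx
  exact (mem_compl.1 (block_subset (isStable_block (x := y)).compl (mem_compl.2 hx) h))
      mem_block_self

theorem mem_block_comm : y ∈ block m p x ↔ x ∈ block m p y :=
  ⟨fun h => block_eq_of_mem h ▸ mem_block_self, fun h => block_eq_of_mem h ▸ mem_block_self⟩

theorem even_card_of_stable (q : Matchings N) (h : ∀ x ∈ S, q.1 x ∈ S) : Even S.card := by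
  have : ∑ _x ∈ S, (1 : ZMod 2) = 0 :=
    sum_involution (fun x _ => q.1 x) (fun _ _ => by decide) (fun x _ _ => q.apply_ne x)
      (fun x hx => h x hx) (fun x _ => q.apply_apply x)
  rw [sum_const, nsmul_one, ZMod.natCast_eq_zero_iff] at this
  exact even_iff_two_dvd.2 this

/-- The set of cycles of the union of the two matchings. -/
noncomputable def blocks (m p : Matchings N) : Finset (Finset (Fin N)) := univ.image (block m p)

theorem block_mem_blocks : block m p x ∈ blocks m p := mem_image_of_mem _ (mem_univ _)

theorem card_blocks_eq_sum : ((blocks m p).card : ℚ) = ∑ x, ((block m p x).card : ℚ)⁻¹ := by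
  rw [← sum_image' (s := univ) (g := block m p) (f := fun _ => (1 : ℚ))]
  · simp [blocks]
  · intro i _
    have : univ.filter (fun j => block m p j = block m p i) = block m p i := by
      ext j
      simp only [mem_filter, mem_univ, true_and]
      exact ⟨fun h => h ▸ mem_block_self, block_eq_of_mem⟩
    rw [this, sum_congr rfl fun j hj => by rw [block_eq_of_mem hj], sum_const, nsmul_eq_mul,
      mul_inv_cancel₀]
    exact_mod_cast (card_pos.2 ⟨i, mem_block_self⟩).ne'

end Blocks

section CycleCount

open Finset Equiv.Perm

variable {N : ℕ}

open Classical in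
/-- The orbit of `x` under `σ`. -/
noncomputable def permOrbit (σ : Equiv.Perm (Fin N)) (x : Fin N) : Finset (Fin N) :=
  univ.filter (σ.SameCycle x)

theorem mem_permOrbit {σ : Equiv.Perm (Fin N)} {x y : Fin N} :
    y ∈ permOrbit σ x ↔ σ.SameCycle x y := by simp [permOrbit]

theorem permOrbit_eq_of_mem {σ : Equiv.Perm (Fin N)} {x y : Fin N} (h : y ∈ permOrbit σ x) :
    permOrbit σ y = permOrbit σ x := by
  ext z
  rw [mem_permOrbit] at h
  rw [mem_permOrbit, mem_permOrbit]
  exact ⟨fun h' => h.trans h', fun h' => h.symm.trans h'⟩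

theorem cycleCount_eq_card_image (σ : Equiv.Perm (Fin N)) :
    cycleCount σ = (univ.image (permOrbit σ)).card := by
  have hsupp : ∀ x ∈ σ.support, permOrbit σ x = (σ.cycleOf x).support := by
    intro x hx
    ext y
    rw [mem_permOrbit, mem_support_cycleOf_iff]
    exact ⟨fun h => ⟨h, hx⟩, fun h => h.1⟩
  have hfix : ∀ x, σ x = x → permOrbit σ x = {x} := by
    intro x hx
    ext y
    rw [mem_permOrbit, mem_singleton]
    constructor
    · intro h; exact (h.eq_of_left hx).symm
    · rintro rfl; exact SameCycle.refl _ _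
  have huniv : univ.image (permOrbit σ) =
      (univ.filter fun x => σ x = x).image (permOrbit σ) ∪ σ.support.image (permOrbit σ) := by
    rw [← image_union]
    congr 1
    ext x
    simp only [mem_univ, mem_union, mem_filter, true_and, mem_support, true_iff]
    exact em _
  rw [huniv, card_union_of_disjoint, cycleCount, add_comm]
  · congr 1
    · rw [card_image_of_injOn]
      intro x hx y hy h
      simp only [coe_filter, mem_univ, true_and, Set.mem_ofPred_eq] at hx hy
      rw [hfix x hx, hfix y hy] at h
      exact singleton_injective h
    · rw [cycleType_def, Multiset.card_map]
      change σ.cycleFactorsFinset.card = _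
      have : σ.support.image (permOrbit σ) = σ.cycleFactorsFinset.image support := by
        ext C
        simp only [mem_image]
        constructor
        · rintro ⟨x, hx, rfl⟩
          exact ⟨σ.cycleOf x, cycleOf_mem_cycleFactorsFinset_iff.2 hx, (hsupp x hx).symm⟩
        · rintro ⟨f, hf, rfl⟩
          obtain ⟨x, hx⟩ := (mem_cycleFactorsFinset_iff.1 hf).1.nonempty_support
          have hx' := mem_cycleFactorsFinset_support_le hf hx
          refine ⟨x, hx', ?_⟩
          rw [hsupp x hx', cycle_is_cycleOf hx hf]
      rw [this, card_image_of_injOn]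
      intro f hf g hg h
      obtain ⟨x, hx⟩ := (mem_cycleFactorsFinset_iff.1 hf).1.nonempty_support
      rw [cycle_is_cycleOf hx hf]
      have hx2 : x ∈ g.support := by rw [← h]; exact hx
      rw [cycle_is_cycleOf hx2 hg]
  · rw [disjoint_left]
    intro C h1 h2
    obtain ⟨x, hx, rfl⟩ := mem_image.1 h1
    obtain ⟨y, hy, h⟩ := mem_image.1 h2
    simp only [mem_filter, mem_univ, true_and] at hx
    rw [hfix x hx] at h
    have : y ∈ ({x} : Finset (Fin N)) := by
      rw [← h, mem_permOrbit]
    rw [mem_singleton] at this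
    subst this
    exact mem_support.1 hy hx

theorem card_image_permOrbit (σ : Equiv.Perm (Fin N)) :
    ((univ.image (permOrbit σ)).card : ℚ) = ∑ x, ((permOrbit σ x).card : ℚ)⁻¹ := by
  have hself : ∀ x, x ∈ permOrbit σ x := fun x => mem_permOrbit.2 (SameCycle.refl _ _)
  rw [← sum_image' (s := univ) (g := permOrbit σ) (f := fun _ => (1 : ℚ))]
  · simp
  · intro i _
    have : univ.filter (fun j => permOrbit σ j = permOrbit σ i) = permOrbit σ i := by
      ext j
      simp only [mem_filter, mem_univ, true_and]
      exact ⟨fun h => h ▸ hself j, permOrbit_eq_of_mem⟩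
    rw [this, sum_congr rfl fun j hj => by rw [permOrbit_eq_of_mem hj], sum_const, nsmul_eq_mul,
      mul_inv_cancel₀]
    exact_mod_cast (card_pos.2 ⟨i, hself i⟩).ne'

variable (m p : Matchings N)

theorem matching_mul_zpow (i : ℤ) (x : Fin N) :
    p.1 (((m.1 * p.1) ^ i) x) = ((m.1 * p.1) ^ (-i)) (p.1 x) := by
  have h : p.1 * (m.1 * p.1) ^ i * (p.1)⁻¹ = (m.1 * p.1) ^ (-i) := by
    rw [← conj_zpow, zpow_neg, ← inv_zpow]
    congr 1
    rw [mul_inv_rev, m.inv_eq, p.inv_eq, mul_assoc, mul_assoc m.1]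
    congr 1
    ext z
    simp [p.apply_apply]
  rw [← h]
  simp

theorem not_sameCycle_matching (x : Fin N) : ¬ (m.1 * p.1).SameCycle x (p.1 x) := by
  rintro ⟨j, hj⟩
  rcases Int.even_or_odd' j with ⟨i, rfl | rfl⟩
  · apply p.apply_ne (((m.1 * p.1) ^ i) x)
    rw [matching_mul_zpow, ← hj, ← Equiv.Perm.mul_apply, ← zpow_add]
    congr 2; ring
  · apply m.apply_ne (((m.1 * p.1) ^ (i + 1)) x)
    have : m.1 (((m.1 * p.1) ^ (i + 1)) x) = (m.1 * p.1) (p.1 (((m.1 * p.1) ^ (i + 1)) x)) := by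
      simp [p.apply_apply]
    rw [this, matching_mul_zpow, ← hj]
    generalize m.1 * p.1 = τ
    rw [← Equiv.Perm.mul_apply, ← Equiv.Perm.mul_apply, ← zpow_one_add, ← zpow_add]
    congr 2; ring

theorem block_eq_union (x : Fin N) :
    block m p x = permOrbit (m.1 * p.1) x ∪ permOrbit (m.1 * p.1) (p.1 x) := by
  have hp : ∀ {u v}, v ∈ permOrbit (m.1 * p.1) u →
      p.1 v ∈ permOrbit (m.1 * p.1) (p.1 u) ∧ m.1 v ∈ permOrbit (m.1 * p.1) (p.1 u) := by
    intro u v h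
    have h1 : p.1 v ∈ permOrbit (m.1 * p.1) (p.1 u) := by
      obtain ⟨i, rfl⟩ := mem_permOrbit.1 h
      exact mem_permOrbit.2 ⟨-i, (matching_mul_zpow m p i u).symm⟩
    refine ⟨h1, ?_⟩
    have : m.1 v = (m.1 * p.1) (p.1 v) := by simp [p.apply_apply]
    rw [this, mem_permOrbit, sameCycle_apply_right]
    exact mem_permOrbit.1 h1
  apply subset_antisymm
  · apply block_subset
    · intro y hy
      rcases mem_union.1 hy with h | h
      · exact ⟨mem_union_right _ (hp h).2, mem_union_right _ (hp h).1⟩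
      · have := hp h
        rw [p.apply_apply] at this
        exact ⟨mem_union_left _ this.2, mem_union_left _ this.1⟩
    · exact mem_union_left _ (mem_permOrbit.2 (SameCycle.refl _ _))
  · have key : ∀ z, permOrbit (m.1 * p.1) z ⊆ block m p z := by
      intro z y hy
      obtain ⟨i, -, -, rfl⟩ := (mem_permOrbit.1 hy).exists_pow_eq
      clear hy
      induction i with
      | zero => simpa using mem_block_self
      | succ i ih =>
        rw [pow_succ']
        exact (isStable_block _ (isStable_block _ ih).2).1
    refine union_subset (key x) ((key _).trans ?_)
    rw [block_eq_of_mem (isStable_block x mem_block_self).2]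

theorem card_block (x : Fin N) :
    (block m p x).card = 2 * (permOrbit (m.1 * p.1) x).card := by
  rw [block_eq_union, card_union_of_disjoint, two_mul]
  · congr 1
    symm
    refine card_bij (fun y _ => p.1 y) ?_ (fun _ _ _ _ h => p.1.injective h) ?_
    · intro y hy
      obtain ⟨i, rfl⟩ := mem_permOrbit.1 hy
      exact mem_permOrbit.2 ⟨-i, (matching_mul_zpow m p i x).symm⟩
    · intro y hy
      obtain ⟨i, rfl⟩ := mem_permOrbit.1 hy
      refine ⟨((m.1 * p.1) ^ (-i)) x, mem_permOrbit.2 ⟨-i, rfl⟩, ?_⟩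
      rw [matching_mul_zpow, neg_neg]
  · rw [disjoint_left]
    intro y h1 h2
    exact not_sameCycle_matching m p x
      ((mem_permOrbit.1 h1).trans (mem_permOrbit.1 h2).symm)

theorem loopCount_eq_card_blocks : loopCount m p = (blocks m p).card := by
  have h : (cycleCount (m.1 * p.1) : ℚ) = 2 * (blocks m p).card := by
    rw [cycleCount_eq_card_image, card_image_permOrbit, card_blocks_eq_sum, mul_sum]
    refine sum_congr rfl fun x _ => ?_
    rw [card_block]
    push_cast
    rw [mul_inv]
    ring
  have h' : cycleCount (m.1 * p.1) = 2 * (blocks m p).card := by exact_mod_cast h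
  rw [loopCount, h']
  omega

end CycleCount

section Action

open Finset Equiv.Perm

variable {N : ℕ}

instance : MulAction (Equiv.Perm (Fin N)) (Matchings N) where
  smul σ m := ⟨σ * m.1 * σ⁻¹, fun x => by simp [m.apply_apply], fun x h =>
    m.apply_ne (σ⁻¹ x) (by rw [Equiv.Perm.eq_inv_iff_eq]; simpa using h)⟩
  one_smul m := Subtype.ext (by change 1 * m.1 * 1⁻¹ = m.1; simp)
  mul_smul σ τ m := Subtype.ext (by
    change σ * τ * m.1 * (σ * τ)⁻¹ = σ * (τ * m.1 * τ⁻¹) * σ⁻¹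
    simp [mul_assoc])

theorem Matchings.smul_val (σ : Equiv.Perm (Fin N)) (m : Matchings N) :
    (σ • m).1 = σ * m.1 * σ⁻¹ := rfl

theorem Matchings.swap_smul_apply (a b x : Fin N) (m : Matchings N) :
    (Equiv.swap a b • m).1 x = Equiv.swap a b (m.1 (Equiv.swap a b x)) := by
  simp [Matchings.smul_val]

theorem Matchings.smul_eq_iff {σ : Equiv.Perm (Fin N)} {m p : Matchings N} :
    σ • m = p ↔ ∀ x, σ (m.1 x) = p.1 (σ x) := by
  constructor
  · rintro rfl x
    simp [Matchings.smul_val]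
  · intro h
    apply Subtype.ext
    ext x
    simp [Matchings.smul_val, h]

theorem cycleCount_conj (σ τ : Equiv.Perm (Fin N)) : cycleCount (σ * τ * σ⁻¹) = cycleCount τ := by
  rw [cycleCount, cycleCount, cycleType_conj]
  congr 1
  symm
  refine card_bij (fun x _ => σ x) ?_ (fun _ _ _ _ h => σ.injective h) ?_
  · intro x hx
    rw [mem_filter] at hx ⊢
    simpa using hx
  · intro y hy
    refine ⟨σ⁻¹ y, ?_, by simp⟩
    rw [mem_filter] at hy ⊢
    refine ⟨mem_univ _, ?_⟩
    rw [Equiv.Perm.eq_inv_iff_eq]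
    exact hy.2

theorem loopCount_smul (σ : Equiv.Perm (Fin N)) (m p : Matchings N) :
    loopCount (σ • m) (σ • p) = loopCount m p := by
  have h : (σ • m).1 * (σ • p).1 = σ * (m.1 * p.1) * σ⁻¹ := by
    simp [Matchings.smul_val, mul_assoc]
  rw [loopCount, loopCount, h, cycleCount_conj]

theorem isCycleOn_permOrbit (τ : Equiv.Perm (Fin N)) (a : Fin N) :
    τ.IsCycleOn (permOrbit τ a : Set (Fin N)) := by
  refine ⟨⟨fun x hx => ?_, τ.injective.injOn, fun x hx => ⟨τ⁻¹ x, ?_, by simp⟩⟩,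
    fun x hx y hy => ?_⟩
  · rw [mem_coe, mem_permOrbit] at *
    exact sameCycle_apply_right.2 hx
  · rw [mem_coe, mem_permOrbit] at *
    exact sameCycle_symm_apply_right.2 hx
  · rw [mem_coe, mem_permOrbit] at hx hy
    exact hx.symm.trans hy

/-- Walk around a cycle of the union of two matchings, starting at `a`. -/
def cycleWalk (m p : Matchings N) (a : Fin N) : ℤ × Bool → Fin N
  | (i, false) => ((m.1 * p.1) ^ i) a
  | (i, true) => p.1 (((m.1 * p.1) ^ i) a)

theorem cycleWalk_eq_iff (m p : Matchings N) (a : Fin N) (u v : ℤ × Bool) :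
    cycleWalk m p a u = cycleWalk m p a v ↔
      u.2 = v.2 ∧ u.1 ≡ v.1 [ZMOD (permOrbit (m.1 * p.1) a).card] := by
  have hne : ∀ i j : ℤ, ((m.1 * p.1) ^ i) a ≠ p.1 (((m.1 * p.1) ^ j) a) := by
    intro i j h
    apply not_sameCycle_matching m p a
    refine ⟨j + i, ?_⟩
    rw [zpow_add, Equiv.Perm.mul_apply, h, matching_mul_zpow, ← Equiv.Perm.mul_apply, ← zpow_add]
    simp
  have heq : ∀ i j : ℤ, ((m.1 * p.1) ^ i) a = ((m.1 * p.1) ^ j) a ↔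
      i ≡ j [ZMOD (permOrbit (m.1 * p.1) a).card] := fun i j =>
    (isCycleOn_permOrbit (m.1 * p.1) a).zpow_apply_eq_zpow_apply
      (mem_permOrbit.2 (SameCycle.refl _ _))
  rcases u with ⟨i, _ | _⟩ <;> rcases v with ⟨j, _ | _⟩
  · simpa [cycleWalk] using heq i j
  · simpa [cycleWalk] using hne i j
  · simpa [cycleWalk] using (hne j i).symm
  · simpa [cycleWalk] using heq i j

theorem apply_right_cycleWalk (m p : Matchings N) (a : Fin N) (i : ℤ) (b : Bool) :
    p.1 (cycleWalk m p a (i, b)) = cycleWalk m p a (i, !b) := by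
  cases b <;> simp [cycleWalk, p.apply_apply]

theorem apply_left_cycleWalk (m p : Matchings N) (a : Fin N) (i : ℤ) (b : Bool) :
    m.1 (cycleWalk m p a (i, b)) =
      cycleWalk m p a (if b then i + 1 else i - 1, !b) := by
  cases b
  · have : m.1 (((m.1 * p.1) ^ i) a) = (m.1 * p.1) (p.1 (((m.1 * p.1) ^ i) a)) := by
      simp [p.apply_apply]
    simp only [cycleWalk, Bool.not_false, this, matching_mul_zpow]
    generalize m.1 * p.1 = τ
    rw [← Equiv.Perm.mul_apply, ← zpow_one_add]
    simp [sub_eq_add_neg, add_comm]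
  · simp only [cycleWalk, Bool.not_true, if_true]
    generalize hτ : m.1 * p.1 = τ
    rw [add_comm, zpow_one_add, ← hτ]
    simp

theorem cycleWalk_surjective {m p : Matchings N} (h : loopCount m p = 1) (a : Fin N) :
    Function.Surjective (cycleWalk m p a) := by
  rw [loopCount_eq_card_blocks, card_eq_one] at h
  obtain ⟨C, hC⟩ := h
  have hb : ∀ x, block m p x = C := fun x => by
    have := block_mem_blocks (m := m) (p := p) (x := x)
    rwa [hC, mem_singleton] at this
  intro x
  have hx : x ∈ block m p a := by rw [hb a, ← hb x]; exact mem_block_self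
  rw [block_eq_union, mem_union, mem_permOrbit, mem_permOrbit] at hx
  rcases hx with ⟨i, hi⟩ | ⟨i, hi⟩
  · exact ⟨(i, false), hi⟩
  · refine ⟨(-i, true), ?_⟩
    rw [cycleWalk, matching_mul_zpow, neg_neg, hi]

theorem card_permOrbit_of_loopCount_eq_one {m p : Matchings N} (h : loopCount m p = 1)
    (a : Fin N) : 2 * (permOrbit (m.1 * p.1) a).card = N := by
  rw [← card_block]
  rw [loopCount_eq_card_blocks, card_eq_one] at h
  obtain ⟨C, hC⟩ := h
  have hb : ∀ x, block m p x = C := fun x => by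
    have := block_mem_blocks (m := m) (p := p) (x := x)
    rwa [hC, mem_singleton] at this
  have : block m p a = univ := by
    ext x
    simp only [mem_univ, iff_true]
    rw [hb a, ← hb x]
    exact mem_block_self
  simp [this]

theorem exists_smul_eq_of_loopCount_eq_one {m p m' p' : Matchings N} (h : loopCount m p = 1)
    (h' : loopCount m' p' = 1) : ∃ σ : Equiv.Perm (Fin N), σ • m = m' ∧ σ • p = p' := by
  rcases isEmpty_or_nonempty (Fin N) with hN | ⟨⟨a⟩⟩
  · exact ⟨1, Matchings.smul_eq_iff.2 hN.elim, Matchings.smul_eq_iff.2 hN.elim⟩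
  have hs := cycleWalk_surjective h a
  have hcard : (permOrbit (m.1 * p.1) a).card = (permOrbit (m'.1 * p'.1) a).card := by
    have h1 := card_permOrbit_of_loopCount_eq_one h a
    have h2 := card_permOrbit_of_loopCount_eq_one h' a
    omega
  have hker : ∀ u v, cycleWalk m p a u = cycleWalk m p a v ↔
      cycleWalk m' p' a u = cycleWalk m' p' a v := fun u v => by
    rw [cycleWalk_eq_iff, cycleWalk_eq_iff, hcard]
  let f : Fin N → Fin N := fun x => cycleWalk m' p' a (Function.surjInv hs x)
  have hf : ∀ u, f (cycleWalk m p a u) = cycleWalk m' p' a u := fun u =>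
    (hker _ _).1 (Function.surjInv_eq hs _)
  have hinj : Function.Injective f := by
    intro x y hxy
    have := (hker _ _).2 hxy
    rwa [Function.surjInv_eq hs, Function.surjInv_eq hs] at this
  refine ⟨Equiv.ofBijective f (Finite.injective_iff_bijective.1 hinj), ?_, ?_⟩
  · refine Matchings.smul_eq_iff.2 fun x => ?_
    obtain ⟨⟨i, b⟩, rfl⟩ := hs x
    simp only [Equiv.ofBijective_apply]
    rw [apply_left_cycleWalk, hf, hf, apply_left_cycleWalk]
  · refine Matchings.smul_eq_iff.2 fun x => ?_
    obtain ⟨⟨i, b⟩, rfl⟩ := hs x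
    simp only [Equiv.ofBijective_apply]
    rw [apply_right_cycleWalk, hf, hf, apply_right_cycleWalk]

theorem exists_smul_eq (m p : Matchings N) : ∃ σ : Equiv.Perm (Fin N), σ • m = p := by
  have key : ∀ q : Matchings N, q.1.cycleType = Multiset.replicate (N / 2) 2 := by
    intro q
    have hq : q.1 ^ 2 = 1 := by ext x; simp [pow_two, q.apply_apply]
    have h2 := q.1.cycleType_of_pow_prime_eq_one hq
    have hs : q.1.support = univ := by ext x; simp [q.apply_ne]
    have h3 := q.1.sum_cycleType
    rw [hs, card_univ, Fintype.card_fin, h2, Multiset.sum_replicate, smul_eq_mul] at h3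
    rw [h2]
    congr 1
    omega
  have : IsConj m.1 p.1 := isConj_iff_cycleType_eq.2 (by rw [key, key])
  obtain ⟨c, hc⟩ := isConj_iff.1 this
  exact ⟨c, Subtype.ext hc⟩

end Action

section SwapBlocks

open Finset

variable {N : ℕ} {m p : Matchings N} {a b x : Fin N} {S : Finset (Fin N)}

theorem swap_smul_swap_smul (a b : Fin N) (m : Matchings N) :
    Equiv.swap a b • Equiv.swap a b • m = m := by
  rw [smul_smul, Equiv.swap_mul_self, one_smul]

theorem IsStable.swap_smul (hS : IsStable m p S) (h : a ∈ S ↔ b ∈ S) :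
    IsStable (Equiv.swap a b • m) p S := by
  have hs : ∀ y ∈ S, Equiv.swap a b y ∈ S := by
    intro y hy
    rcases eq_or_ne y a with rfl | ha
    · rw [Equiv.swap_apply_left]; exact h.1 hy
    rcases eq_or_ne y b with rfl | hb
    · rw [Equiv.swap_apply_right]; exact h.2 hy
    rwa [Equiv.swap_apply_of_ne_of_ne ha hb]
  intro y hy
  rw [Matchings.swap_smul_apply]
  exact ⟨hs _ (hS _ (hs _ hy)).1, (hS y hy).2⟩

theorem mem_block_swap_smul (h : b ∉ block m p a) : b ∈ block (Equiv.swap a b • m) p a := by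
  by_contra hb
  set D := block (Equiv.swap a b • m) p a with hD
  set A := block m p a with hA
  have hDs : IsStable (Equiv.swap a b • m) p D := isStable_block
  have hAs : IsStable m p A := isStable_block
  have h1 : Even (D ∩ A).card := even_card_of_stable p fun y hy => by
    rw [mem_inter] at hy ⊢
    exact ⟨(hDs y hy.1).2, (hAs y hy.2).2⟩
  have h2 : Even ((D ∩ A).erase a).card := even_card_of_stable m fun y hy => by
    rw [mem_erase, mem_inter] at hy ⊢
    obtain ⟨hya, hyD, hyA⟩ := hy
    have hyb : y ≠ b := fun e => hb (e ▸ hyD)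
    have h3 := (hDs y hyD).1
    have h4 := (hAs y hyA).1
    rw [Matchings.swap_smul_apply, Equiv.swap_apply_of_ne_of_ne hya hyb] at h3
    have h5 : m.1 y ≠ a := fun e => hb (by rwa [e, Equiv.swap_apply_left] at h3)
    have h6 : m.1 y ≠ b := fun e => h (e ▸ h4)
    rw [Equiv.swap_apply_of_ne_of_ne h5 h6] at h3
    exact ⟨h5, h3, h4⟩
  have ha : a ∈ D ∩ A := mem_inter.2 ⟨mem_block_self, mem_block_self⟩
  have := card_erase_add_one ha
  rw [Nat.even_iff] at h1 h2
  omega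

theorem block_swap_smul (h : b ∉ block m p a) :
    block (Equiv.swap a b • m) p x =
      if x ∈ block m p a ∪ block m p b then block m p a ∪ block m p b else block m p x := by
  have ha : a ∈ block m p a ∪ block m p b := mem_union_left _ mem_block_self
  have hb : b ∈ block m p a ∪ block m p b := mem_union_right _ mem_block_self
  have hT : block (Equiv.swap a b • m) p a = block m p a ∪ block m p b := by
    apply subset_antisymm
    · exact block_subset
        ((isStable_block.union isStable_block).swap_smul (by simp only [ha, hb])) ha
    · have hs : IsStable m p (block (Equiv.swap a b • m) p a) := by
        have := (isStable_block (m := Equiv.swap a b • m) (p := p) (x := a)).swap_smul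
          (a := a) (b := b) (by simp only [mem_block_self, mem_block_swap_smul h])
        rwa [swap_smul_swap_smul] at this
      exact union_subset (block_subset hs mem_block_self) (block_subset hs (mem_block_swap_smul h))
  split_ifs with hx
  · rw [← hT] at hx ⊢
    exact block_eq_of_mem hx
  · have hxa : a ∉ block m p x := fun h' => hx (mem_union_left _ (mem_block_comm.1 h'))
    have hxb : b ∉ block m p x := fun h' => hx (mem_union_right _ (mem_block_comm.1 h'))
    have hsub : block (Equiv.swap a b • m) p x ⊆ block m p x :=
      block_subset (isStable_block.swap_smul (by simp only [hxa, hxb])) mem_block_self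
    refine hsub.antisymm (block_subset ?_ mem_block_self)
    have := (isStable_block (m := Equiv.swap a b • m) (p := p) (x := x)).swap_smul
      (a := a) (b := b) (iff_of_false (fun h' => hxa (hsub h')) fun h' => hxb (hsub h'))
    rwa [swap_smul_swap_smul] at this

theorem blocks_swap_smul (h : b ∉ block m p a) :
    blocks (Equiv.swap a b • m) p =
      insert (block m p a ∪ block m p b)
          (((blocks m p).erase (block m p a)).erase (block m p b)) := by
  ext C
  simp only [blocks, mem_image, mem_univ, true_and, mem_insert, mem_erase]
  constructor
  · rintro ⟨x, rfl⟩
    rw [block_swap_smul h]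
    split_ifs with hx
    · exact Or.inl rfl
    · rw [mem_union, not_or] at hx
      exact Or.inr ⟨fun e => hx.2 (e ▸ mem_block_self), fun e => hx.1 (e ▸ mem_block_self), x, rfl⟩
  · rintro (rfl | ⟨h1, h2, x, rfl⟩)
    · exact ⟨a, by rw [block_swap_smul h, if_pos (mem_union_left _ mem_block_self)]⟩
    · refine ⟨x, ?_⟩
      rw [block_swap_smul h, if_neg]
      rw [mem_union, not_or]
      exact ⟨fun e => h2 (block_eq_of_mem e), fun e => h1 (block_eq_of_mem e)⟩

theorem union_block_notMem :
    block m p a ∪ block m p b ∉ ((blocks m p).erase (block m p a)).erase (block m p b) := by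
  intro h
  simp only [blocks, mem_image, mem_univ, true_and, mem_erase] at h
  obtain ⟨-, h2, x, hx⟩ := h
  have : a ∈ block m p x := hx ▸ mem_union_left _ mem_block_self
  exact h2 (by rw [← hx, ← block_eq_of_mem this])

theorem block_mem_erase (h : b ∉ block m p a) :
    block m p b ∈ (blocks m p).erase (block m p a) :=
  mem_erase.2 ⟨fun e => h (e ▸ mem_block_self), block_mem_blocks⟩

theorem loopCount_swap_smul_add_one (h : b ∉ block m p a) :
    loopCount (Equiv.swap a b • m) p + 1 = loopCount m p := by
  rw [loopCount_eq_card_blocks, loopCount_eq_card_blocks, blocks_swap_smul h,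
    card_insert_of_notMem union_block_notMem, card_erase_add_one (block_mem_erase h),
    card_erase_add_one block_mem_blocks]

theorem loopCount_le_swap_smul (h : b ∈ block m p a) :
    loopCount m p ≤ loopCount (Equiv.swap a b • m) p := by
  rw [loopCount_eq_card_blocks, loopCount_eq_card_blocks]
  have hsub : ∀ x, block (Equiv.swap a b • m) p x ⊆ block m p x := fun x => by
    refine block_subset (isStable_block.swap_smul ?_) mem_block_self
    rw [mem_block_comm, mem_block_comm (x := x) (y := b), block_eq_of_mem h]
  have : blocks m p = (blocks (Equiv.swap a b • m) p).image fun D => D.biUnion (block m p) := by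
    rw [blocks, blocks, image_image]
    refine image_congr fun x _ => ?_
    simp only [Function.comp]
    apply subset_antisymm
    · intro y hy
      exact mem_biUnion.2 ⟨x, mem_block_self, hy⟩
    · intro y hy
      obtain ⟨z, hz, hy⟩ := mem_biUnion.1 hy
      rwa [block_eq_of_mem (hsub x hz)] at hy
  rw [this]
  exact card_image_le

/-- The product of the half sizes of the cycles of the union of the two matchings. -/
noncomputable def blockWeight (m p : Matchings N) : ℝ := ∏ C ∈ blocks m p, (C.card : ℝ) / 2

/-- Half the size of the cycle through `x`. -/
noncomputable def halfSize (m p : Matchings N) (x : Fin N) : ℝ := ((block m p x).card : ℝ) / 2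

theorem halfSize_pos : 0 < halfSize m p x := by
  have : 0 < (block m p x).card := card_pos.2 ⟨x, mem_block_self⟩
  rw [halfSize]
  positivity

theorem card_union_block (h : b ∉ block m p a) :
    (((block m p a ∪ block m p b).card : ℝ)) / 2 = halfSize m p a + halfSize m p b := by
  rw [card_union_of_disjoint, halfSize, halfSize]
  · push_cast; ring
  · rw [disjoint_left]
    intro y h1 h2
    apply h
    rw [← block_eq_of_mem h1, block_eq_of_mem h2]
    exact mem_block_self

theorem blockWeight_swap_smul (h : b ∉ block m p a) :
    blockWeight (Equiv.swap a b • m) p * (halfSize m p a * halfSize m p b) =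
      blockWeight m p * (halfSize m p a + halfSize m p b) := by
  rw [blockWeight, blocks_swap_smul h, prod_insert union_block_notMem, card_union_block h,
    blockWeight, ← mul_prod_erase (blocks m p) _ (block_mem_blocks (x := a)),
    ← mul_prod_erase _ _ (block_mem_erase h), halfSize, halfSize]
  ring

theorem halfSize_swap_smul (h : b ∉ block m p a) :
    halfSize (Equiv.swap a b • m) p a = halfSize m p a + halfSize m p b := by
  rw [halfSize, block_swap_smul h, if_pos (mem_union_left _ mem_block_self), card_union_block h]

theorem sum_inv_halfSize : ∑ x, (halfSize m p x)⁻¹ = 2 * loopCount m p := by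
  have h := card_blocks_eq_sum (m := m) (p := p)
  rw [← loopCount_eq_card_blocks] at h
  have h' : ((loopCount m p : ℚ) : ℝ) = ((∑ x, ((block m p x).card : ℚ)⁻¹ : ℚ) : ℝ) := by rw [h]
  push_cast at h'
  rw [h', mul_sum]
  refine sum_congr rfl fun x _ => ?_
  rw [halfSize, inv_div, div_eq_mul_inv]

end SwapBlocks

section JucysMurphy

open Finset

variable {N : ℕ}

/-- The real functions on matchings. -/
abbrev MatchingSpace (N : ℕ) : Type := EuclideanSpace ℝ (Matchings N)

/-- The permutation representation on functions on matchings. -/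
noncomputable def matchingRep : Equiv.Perm (Fin N) →* Module.End ℝ (MatchingSpace N) where
  toFun σ :=
    { toFun := fun f => WithLp.toLp 2 fun m => f (σ⁻¹ • m)
      map_add' := fun _ _ => rfl
      map_smul' := fun _ _ => rfl }
  map_one' := by ext; simp
  map_mul' σ τ := by
    ext f m
    change f ((σ * τ)⁻¹ • m) = f (τ⁻¹ • σ⁻¹ • m)
    rw [mul_inv_rev, mul_smul]

theorem matchingRep_apply (σ : Equiv.Perm (Fin N)) (f : MatchingSpace N) (m : Matchings N) :
    matchingRep σ f m = f (σ⁻¹ • m) := rfl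

theorem inner_matchingRep (σ : Equiv.Perm (Fin N)) (f g : MatchingSpace N) :
    inner ℝ (matchingRep σ f) g = inner ℝ f (matchingRep σ⁻¹ g) := by
  simp only [PiLp.inner_apply, matchingRep_apply, inv_inv]
  exact Fintype.sum_equiv (MulAction.toPerm σ⁻¹) _ _ fun m => by simp

/-- The Jucys–Murphy element at position `q`. -/
noncomputable def jucysMurphy (q : Fin N) : Module.End ℝ (MatchingSpace N) :=
  ∑ i ∈ Iio q, matchingRep (Equiv.swap i q)

theorem jucysMurphy_apply (q : Fin N) (f : MatchingSpace N) (m : Matchings N) :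
    jucysMurphy q f m = ∑ i ∈ Iio q, f (Equiv.swap i q • m) := by
  simp [jucysMurphy, LinearMap.sum_apply, matchingRep_apply]

theorem isSymmetric_jucysMurphy (q : Fin N) : (jucysMurphy q).IsSymmetric := by
  intro f g
  simp only [jucysMurphy, LinearMap.sum_apply, sum_inner, inner_sum, inner_matchingRep,
    Equiv.swap_inv]

theorem commute_matchingRep_jucysMurphy {σ : Equiv.Perm (Fin N)} {q : Fin N} (hq : σ q = q)
    (h : ∀ k, k < q → σ k < q) : Commute (matchingRep σ) (jucysMurphy q) := by
  rw [Commute, SemiconjBy, jucysMurphy, mul_sum, sum_mul]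
  have hinj : Set.InjOn σ (Iio q : Finset (Fin N)) := σ.injective.injOn
  have himg : (Iio q).image σ = Iio q :=
    eq_of_subset_of_card_le (fun y hy => by
      obtain ⟨k, hk, rfl⟩ := mem_image.1 hy
      exact mem_Iio.2 (h k (mem_Iio.1 hk))) (card_image_of_injOn hinj).ge
  conv_rhs => rw [← himg, sum_image hinj]
  refine sum_congr rfl fun k _ => ?_
  rw [← map_mul, ← map_mul]
  congr 1
  have := Equiv.swap_apply_apply σ k q
  rw [hq] at this
  rw [this]
  group

theorem commute_jucysMurphy (p q : Fin N) : Commute (jucysMurphy p) (jucysMurphy q) := by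
  have key : ∀ {p q : Fin N}, p < q → Commute (jucysMurphy p) (jucysMurphy q) := by
    intro p q hpq
    rw [jucysMurphy]
    refine Commute.sum_left _ _ _ fun i hi => ?_
    have hi := mem_Iio.1 hi
    refine commute_matchingRep_jucysMurphy ?_ fun k hk => ?_
    · exact Equiv.swap_apply_of_ne_of_ne (hi.trans hpq).ne' hpq.ne'
    · rcases eq_or_ne k i with rfl | h1
      · rwa [Equiv.swap_apply_left]
      rcases eq_or_ne k p with rfl | h2
      · rw [Equiv.swap_apply_right]; exact hi.trans hpq
      rwa [Equiv.swap_apply_of_ne_of_ne h1 h2]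
  rcases lt_trichotomy p q with h | rfl | h
  · exact key h
  · exact Commute.refl _
  · exact (key h).symm

theorem commute_swap_jucysMurphy {i j q : Fin N} (hij : (j : ℕ) = i + 1) (h1 : q ≠ i) (h2 : q ≠ j) :
    Commute (matchingRep (Equiv.swap i j)) (jucysMurphy q) := by
  refine commute_matchingRep_jucysMurphy (Equiv.swap_apply_of_ne_of_ne h1 h2) fun k hk => ?_
  rcases eq_or_ne k i with rfl | h3
  · rw [Equiv.swap_apply_left]
    omega
  rcases eq_or_ne k j with rfl | h4
  · rw [Equiv.swap_apply_right]
    omega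
  rwa [Equiv.swap_apply_of_ne_of_ne h3 h4]

theorem jucysMurphy_succ_mul_swap {i j : Fin N} (hij : (j : ℕ) = i + 1) :
    jucysMurphy j * matchingRep (Equiv.swap i j) =
      matchingRep (Equiv.swap i j) * jucysMurphy i + 1 := by
  have hI : Iio j = insert i (Iio i) := by
    ext k
    simp only [mem_Iio, mem_insert]
    omega
  rw [jucysMurphy, hI, sum_insert (by simp), add_mul, ← map_mul, Equiv.swap_mul_self, map_one,
    add_comm, jucysMurphy, mul_sum, sum_mul]
  congr 1
  refine sum_congr rfl fun k hk => ?_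
  have hk := mem_Iio.1 hk
  rw [← map_mul, ← map_mul]
  congr 1
  have h := Equiv.swap_apply_apply (Equiv.swap i j) k i
  rw [Equiv.swap_apply_left, Equiv.swap_apply_of_ne_of_ne (by omega) (by omega)] at h
  rw [h]
  simp

theorem jucysMurphy_mul_swap {i j : Fin N} (hij : (j : ℕ) = i + 1) :
    jucysMurphy i * matchingRep (Equiv.swap i j) =
      matchingRep (Equiv.swap i j) * jucysMurphy j - 1 := by
  have hs : matchingRep (Equiv.swap i j) * matchingRep (Equiv.swap i j) = 1 := by
    rw [← map_mul, Equiv.swap_mul_self, map_one]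
  have h := jucysMurphy_succ_mul_swap hij
  generalize matchingRep (Equiv.swap i j) = s at *
  have h1 : jucysMurphy j = s * jucysMurphy i * s + s := by
    calc jucysMurphy j = jucysMurphy j * s * s := by rw [mul_assoc, hs, mul_one]
      _ = _ := by rw [h, add_mul, one_mul]
  rw [h1, mul_add, ← mul_assoc, ← mul_assoc, hs, one_mul, add_sub_cancel_right]

/-- `v` is a joint eigenvector with content vector `a`. -/
def IsContentVector (a : Fin N → ℝ) (v : MatchingSpace N) : Prop :=
  v ≠ 0 ∧ ∀ q, jucysMurphy q v = a q • v

namespace IsContentVector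

variable {a : Fin N → ℝ} {v : MatchingSpace N} {i j : Fin N}

theorem ne (hv : IsContentVector a v) (hij : (j : ℕ) = i + 1) : a i ≠ a j := by
  intro h
  apply hv.1
  have h1 : jucysMurphy j (matchingRep (Equiv.swap i j) v) =
      a i • matchingRep (Equiv.swap i j) v + v := by
    have := LinearMap.congr_fun (jucysMurphy_succ_mul_swap hij) v
    simpa [hv.2] using this
  have h2 := isSymmetric_jucysMurphy j (matchingRep (Equiv.swap i j) v) v
  rw [h1, hv.2, inner_add_left, inner_smul_left, inner_smul_right, h] at h2
  simpa using h2

/-- The component of `s v` orthogonal to `v`, for `s` the adjacent transposition. -/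
theorem swapped (hv : IsContentVector a v) (hij : (j : ℕ) = i + 1) {w : MatchingSpace N}
    (hw : w = matchingRep (Equiv.swap i j) v - (a j - a i)⁻¹ • v) :
    (∀ q, jucysMurphy q w = a (Equiv.swap i j q) • w) ∧
      inner ℝ w w = (1 - ((a j - a i)⁻¹) ^ 2) * inner ℝ v v := by
  have hne : a j - a i ≠ 0 := sub_ne_zero.2 (hv.ne hij).symm
  have h1 : jucysMurphy j (matchingRep (Equiv.swap i j) v) =
      a i • matchingRep (Equiv.swap i j) v + v := by
    have := LinearMap.congr_fun (jucysMurphy_succ_mul_swap hij) v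
    simpa [hv.2] using this
  have h2 : jucysMurphy i (matchingRep (Equiv.swap i j) v) =
      a j • matchingRep (Equiv.swap i j) v - v := by
    have := LinearMap.congr_fun (jucysMurphy_mul_swap hij) v
    simpa [hv.2] using this
  have hJ : ∀ q, jucysMurphy q w = a (Equiv.swap i j q) • w := by
    intro q
    rcases eq_or_ne q i with rfl | hqi
    · rw [Equiv.swap_apply_left, hw, map_sub, map_smul, h2, hv.2]
      match_scalars <;> field_simp
      ring
    rcases eq_or_ne q j with rfl | hqj
    · rw [Equiv.swap_apply_right, hw, map_sub, map_smul, h1, hv.2]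
      match_scalars <;> field_simp
      ring
    · rw [Equiv.swap_apply_of_ne_of_ne hqi hqj, hw, map_sub, map_smul, hv.2]
      have := LinearMap.congr_fun (commute_swap_jucysMurphy hij hqi hqj).eq v
      simp only [Module.End.mul_apply, hv.2, map_smul] at this
      rw [← this, smul_sub, smul_comm]
  refine ⟨hJ, ?_⟩
  have horth : inner ℝ w v = 0 := by
    have h3 := isSymmetric_jucysMurphy i w v
    rw [hJ, hv.2, Equiv.swap_apply_left, inner_smul_left, inner_smul_right] at h3
    have h4 : (a j - a i) * inner ℝ w v = 0 := by
      simp only [conj_trivial] at h3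
      linear_combination h3
    exact (mul_eq_zero.1 h4).resolve_left hne
  have hsv : matchingRep (Equiv.swap i j) v = w + (a j - a i)⁻¹ • v := by rw [hw]; abel
  have hnorm : inner ℝ (matchingRep (Equiv.swap i j) v) (matchingRep (Equiv.swap i j) v) =
      inner ℝ v v := by
    rw [inner_matchingRep, ← Module.End.mul_apply, ← map_mul]
    simp
  rw [hsv, inner_add_left, inner_add_right, inner_add_right, inner_smul_left, inner_smul_right,
    inner_smul_right, inner_smul_left, horth, real_inner_comm w v, horth] at hnorm
  simp only [conj_trivial] at hnorm
  linear_combination hnorm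

theorem swap (hv : IsContentVector a v) (hij : (j : ℕ) = i + 1) (h1 : a j ≠ a i + 1)
    (h2 : a j ≠ a i - 1) : ∃ w, IsContentVector (a ∘ Equiv.swap i j) w := by
  obtain ⟨hJ, hn⟩ := hv.swapped hij rfl
  refine ⟨_, fun hw => ?_, hJ⟩
  rw [hw, inner_zero_left] at hn
  rcases mul_eq_zero.1 hn.symm with h | h
  · have h3 : (a j - a i)⁻¹ ^ 2 = 1 := by linarith
    rw [inv_pow, inv_eq_one, sq_eq_one_iff] at h3
    rcases h3 with h3 | h3
    · exact h1 (by linarith)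
    · exact h2 (by linarith)
  · exact hv.1 (inner_self_eq_zero.1 h)

theorem swap_apply_eq (hv : IsContentVector a v) (hij : (j : ℕ) = i + 1)
    (h : (a j - a i) ^ 2 = 1) : matchingRep (Equiv.swap i j) v = (a j - a i) • v := by
  obtain ⟨-, hn⟩ := hv.swapped hij rfl
  have hinv : (a j - a i)⁻¹ = a j - a i := by
    have h0 : a j - a i ≠ 0 := fun h0 => by rw [h0] at h; norm_num at h
    field_simp
    rw [h]
  rw [hinv, h, sub_self, zero_mul, inner_self_eq_zero, sub_eq_zero] at hn
  exact hn

theorem exists_int (k : ℕ) : ∀ (a : Fin N → ℝ) (v : MatchingSpace N), IsContentVector a v →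
    ∀ q : Fin N, (q : ℕ) = k → ∃ z : ℤ, a q = z := by
  induction k with
  | zero =>
    intro a v hv q hq
    refine ⟨0, ?_⟩
    have h := hv.2 q
    have hI : Iio q = ∅ := by ext k; simp; omega
    rw [jucysMurphy, hI, sum_empty, LinearMap.zero_apply, eq_comm, smul_eq_zero] at h
    simpa using h.resolve_right hv.1
  | succ k ih =>
    intro a v hv q hq
    obtain ⟨z, hz⟩ := ih a v hv ⟨k, by omega⟩ rfl
    by_cases h1 : a q = a ⟨k, by omega⟩ + 1
    · exact ⟨z + 1, by rw [h1, hz]; push_cast; rfl⟩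
    by_cases h2 : a q = a ⟨k, by omega⟩ - 1
    · exact ⟨z - 1, by rw [h2, hz]; push_cast; rfl⟩
    obtain ⟨w, hw⟩ := hv.swap (i := ⟨k, by omega⟩) hq h1 h2
    simpa using ih _ w hw ⟨k, by omega⟩ rfl

end IsContentVector

/-- The integer sequences that occur as content vectors. -/
def contentSet (N : ℕ) : Set (ℕ → ℤ) :=
  {c | ∃ v : MatchingSpace N, IsContentVector (fun q => (c q : ℝ)) v}

theorem isContentSet_contentSet : IsContentSet N (contentSet N) where
  zero := by
    rintro c ⟨v, hv⟩ hN
    have h := hv.2 ⟨0, hN⟩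
    have hI : Iio (⟨0, hN⟩ : Fin N) = ∅ := by ext k; simp [Fin.lt_def]
    rw [jucysMurphy, hI, sum_empty, LinearMap.zero_apply, eq_comm, smul_eq_zero] at h
    simpa using h.resolve_right hv.1
  ne := by
    rintro c ⟨v, hv⟩ i hi h
    exact hv.ne (i := ⟨i, by omega⟩) (j := ⟨i + 1, hi⟩) rfl (by simp [h])
  swap := by
    rintro c ⟨v, hv⟩ i hi h1 h2
    obtain ⟨w, hw⟩ := hv.swap (i := ⟨i, by omega⟩) (j := ⟨i + 1, hi⟩) rfl
      (by dsimp only; exact_mod_cast h1) (by dsimp only; exact_mod_cast h2)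
    refine ⟨w, ?_⟩
    convert hw using 1
    ext q
    simp only [Function.comp]
    rcases eq_or_ne q ⟨i, by omega⟩ with rfl | h3
    · simp
    rcases eq_or_ne q ⟨i + 1, hi⟩ with rfl | h4
    · simp
    · rw [Equiv.swap_apply_of_ne_of_ne h3 h4, Equiv.swap_apply_of_ne_of_ne]
      · exact fun h => h3 (Fin.ext h)
      · exact fun h => h4 (Fin.ext h)
  braid := by
    rintro c ⟨v, hv⟩ i hi h
    rw [← not_or]
    intro hor
    set x : Fin N := ⟨i, by omega⟩ with hx
    set y : Fin N := ⟨i + 1, by omega⟩ with hy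
    set z : Fin N := ⟨i + 2, hi⟩ with hz
    obtain ⟨e, he, he1⟩ : ∃ e : ℝ, ((c (i + 1) : ℝ)) - c i = e ∧ e ^ 2 = 1 := by
      rcases hor with h | h
      · exact ⟨1, by rw [h]; push_cast; ring, by norm_num⟩
      · exact ⟨-1, by rw [h]; push_cast; ring, by norm_num⟩
    have h1 : matchingRep (Equiv.swap x y) v = e • v := by
      have := hv.swap_apply_eq (i := x) (j := y) rfl (by simp only [hx, hy]; rw [he, he1])
      rw [this]
      simp only [hx, hy]
      rw [he]
    have h2 : matchingRep (Equiv.swap y z) v = (-e) • v := by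
      have he' : ((c (i + 2) : ℝ)) - c (i + 1) = -e := by rw [h, ← he]; ring
      have := hv.swap_apply_eq (i := y) (j := z) rfl
        (by simp only [hz, hy]; rw [he', neg_sq, he1])
      rw [this]
      simp only [hz, hy]
      rw [he']
    have hb : Equiv.swap x y * Equiv.swap y z * Equiv.swap x y =
        Equiv.swap y z * Equiv.swap x y * Equiv.swap y z := by
      have hxy : x ≠ y := by simp [hx, hy]
      have hxz : x ≠ z := by simp [hx, hz]
      have hyz : y ≠ z := by simp [hy, hz]
      rw [Equiv.swap_mul_swap_mul_swap hxy hxz, Equiv.swap_comm x y, Equiv.swap_comm y z,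
        Equiv.swap_mul_swap_mul_swap hyz.symm hxz.symm, Equiv.swap_comm]
    have h3 := LinearMap.congr_fun (congrArg matchingRep hb) v
    simp only [map_mul, Module.End.mul_apply, h1, h2, map_smul, smul_smul] at h3
    have h4 : (-2 * e) • v = 0 := by
      rw [← sub_eq_zero, ← sub_smul] at h3
      rw [← h3]
      congr 1
      linear_combination (2 * e) * he1
    rcases smul_eq_zero.1 h4 with h5 | h5
    · have : e = 0 := by linarith
      rw [this] at he1
      norm_num at he1
    · exact hv.1 h5

end JucysMurphy

section GramProduct

open Finset

variable {n : ℕ}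

/-- The map exchanging `2k` and `2k + 1`. -/
def pairFlip (n : ℕ) (x : Fin (2 * n)) : Fin (2 * n) :=
  if (x : ℕ) % 2 = 0 then ⟨(x + 1) % (2 * n), Nat.mod_lt _ x.pos⟩ else ⟨x - 1, by omega⟩

theorem pairFlip_val (x : Fin (2 * n)) :
    (pairFlip n x : ℕ) = if (x : ℕ) % 2 = 0 then (x : ℕ) + 1 else x - 1 := by
  have hx := x.2
  rw [pairFlip]
  split_ifs with h
  · exact Nat.mod_eq_of_lt (by omega)
  · rfl

theorem pairFlip_involutive (n : ℕ) : Function.Involutive (pairFlip n) := by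
  intro x
  apply Fin.ext
  rw [pairFlip_val, pairFlip_val]
  split_ifs <;> omega

/-- The standard matching of `2k` with `2k + 1`. -/
def stdMatching (n : ℕ) : Matchings (2 * n) :=
  ⟨(pairFlip_involutive n).toPerm, pairFlip_involutive n, fun x h => by
    have h : (pairFlip n x : ℕ) = x := congrArg Fin.val h
    rw [pairFlip_val] at h
    split_ifs at h <;> omega⟩

theorem stdMatching_even {k : ℕ} (hk : 2 * k < 2 * n) :
    (stdMatching n).1 ⟨2 * k, hk⟩ = ⟨2 * k + 1, by omega⟩ := by
  apply Fin.ext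
  change (pairFlip n ⟨2 * k, hk⟩ : ℕ) = _
  rw [pairFlip_val, if_pos (by simp)]

theorem stdMatching_odd {k : ℕ} (hk : 2 * k + 1 < 2 * n) :
    (stdMatching n).1 ⟨2 * k + 1, hk⟩ = ⟨2 * k, by omega⟩ := by
  rw [← stdMatching_even (by omega), Matchings.apply_apply]

theorem loopCount_stdMatching : loopCount (stdMatching n) (stdMatching n) = n := by
  have h : (stdMatching n).1 * (stdMatching n).1 = 1 := by
    ext x
    simp [Matchings.apply_apply]
  rw [loopCount, h, cycleCount]
  simp

/-- The matching agrees with the standard one on the pairs with index at least `r`. -/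
def AgreesFrom (r : ℕ) (m : Matchings (2 * n)) : Prop :=
  ∀ k, r ≤ k → ∀ hk : k < n, m.1 ⟨2 * k, by omega⟩ = ⟨2 * k + 1, by omega⟩

namespace AgreesFrom

variable {r k : ℕ} {m : Matchings (2 * n)}

theorem mono {r' : ℕ} (h : AgreesFrom r m) (hr : r ≤ r') : AgreesFrom r' m :=
  fun k hk hkn => h k (hr.trans hk) hkn

theorem odd (h : AgreesFrom r m) (hr : r ≤ k) (hk : k < n) :
    m.1 ⟨2 * k + 1, by omega⟩ = ⟨2 * k, by omega⟩ := by
  rw [← h k hr hk, Matchings.apply_apply]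

theorem apply_eq (h : AgreesFrom r m) {x : Fin (2 * n)} (hx : 2 * r ≤ (x : ℕ)) :
    m.1 x = (stdMatching n).1 x := by
  have hx2 := x.2
  rcases Nat.even_or_odd' (x : ℕ) with ⟨k, hk | hk⟩
  · have : x = ⟨2 * k, by omega⟩ := Fin.ext hk
    rw [this, h k (by omega) (by omega), stdMatching_even]
  · have : x = ⟨2 * k + 1, by omega⟩ := Fin.ext hk
    rw [this, h.odd (by omega) (by omega), stdMatching_odd]

theorem apply_lt (h : AgreesFrom r m) {x : Fin (2 * n)} (hx : (x : ℕ) < 2 * r) :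
    (m.1 x : ℕ) < 2 * r := by
  by_contra hlt
  push Not at hlt
  have h1 := h.apply_eq hlt
  rw [Matchings.apply_apply] at h1
  have hx2 := (m.1 x).2
  rcases Nat.even_or_odd' (m.1 x : ℕ) with ⟨k, hk | hk⟩
  · have h2 : m.1 x = ⟨2 * k, by omega⟩ := Fin.ext hk
    rw [h2, stdMatching_even] at h1
    have := congrArg Fin.val h1
    simp only at this
    omega
  · have h2 : m.1 x = ⟨2 * k + 1, by omega⟩ := Fin.ext hk
    rw [h2, stdMatching_odd] at h1
    have := congrArg Fin.val h1
    simp only at this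
    omega

theorem eq_stdMatching (h : AgreesFrom 1 m) : m = stdMatching n := by
  apply Subtype.ext
  ext x
  by_cases hx : 2 * 1 ≤ (x : ℕ)
  · rw [h.apply_eq hx]
  · have h1 := h.apply_lt (x := x) (by omega)
    have h2 : (m.1 x : ℕ) ≠ x := fun e => m.apply_ne x (Fin.ext e)
    have hx2 := x.2
    rcases (by omega : (x : ℕ) = 0 ∨ (x : ℕ) = 1) with h3 | h3
    · have : x = ⟨2 * 0, by omega⟩ := Fin.ext h3
      have h4 : ((stdMatching n).1 x : ℕ) = 1 := by rw [this, stdMatching_even]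
      omega
    · have : x = ⟨2 * 0 + 1, by omega⟩ := Fin.ext h3
      have h4 : ((stdMatching n).1 x : ℕ) = 0 := by rw [this, stdMatching_odd]
      omega

/-- The pairs above `r` are unaffected by a transposition below. -/
theorem swap_smul_iff (a b : Fin (2 * n)) (ha : (a : ℕ) < 2 * r) (hb : (b : ℕ) < 2 * r) :
    AgreesFrom r (Equiv.swap a b • m) ↔ AgreesFrom r m := by
  refine forall_congr' fun k => forall_congr' fun hr => forall_congr' fun hk => ?_
  rw [Matchings.swap_smul_apply, Equiv.swap_apply_of_ne_of_ne (a := a) (b := b) (x := ⟨2 * k, _⟩)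
    (Fin.ne_of_val_ne (by simp only; omega)) (Fin.ne_of_val_ne (by simp only; omega))]
  generalize m.1 = τ
  rw [Equiv.swap_apply_eq_iff, Equiv.swap_apply_of_ne_of_ne
    (Fin.ne_of_val_ne (by simp only; omega)) (Fin.ne_of_val_ne (by simp only; omega))]

theorem block_pair (h : AgreesFrom r m) (hr : r ≤ k) (hk : k < n) :
    block m (stdMatching n) ⟨2 * k, by omega⟩ = {⟨2 * k, by omega⟩, ⟨2 * k + 1, by omega⟩} := by
  apply subset_antisymm
  · refine block_subset (fun x hx => ?_) (by simp)
    rw [mem_insert, mem_singleton] at hx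
    rcases hx with rfl | rfl
    · rw [h k hr hk, stdMatching_even]; simp
    · rw [h.odd hr hk, stdMatching_odd]; simp
  · intro x hx
    rw [mem_insert, mem_singleton] at hx
    rcases hx with rfl | rfl
    · exact mem_block_self
    · rw [← h k hr hk]
      exact (isStable_block _ mem_block_self).1

end AgreesFrom

/-- The Jucys–Murphy element at the first position of the `k`-th pair. -/
noncomputable def evenJM (n k : ℕ) : Module.End ℝ (MatchingSpace (2 * n)) :=
  if h : k < n then jucysMurphy ⟨2 * k, by omega⟩ else 0

theorem evenJM_apply {k : ℕ} (hk : k < n) (f : MatchingSpace (2 * n)) (m : Matchings (2 * n)) :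
    evenJM n k f m = ∑ i ∈ Iio (⟨2 * k, by omega⟩ : Fin (2 * n)),
      f (Equiv.swap i ⟨2 * k, by omega⟩ • m) := by
  rw [evenJM, dif_pos hk, jucysMurphy_apply]

/-- The indicator function of the standard matching. -/
noncomputable def stdVec (n : ℕ) : MatchingSpace (2 * n) := EuclideanSpace.single (stdMatching n) 1

/-- The vector `∏ k ∈ [1, r], (d + J_{2k})` applied to `stdVec n`. -/
noncomputable def gramPartial (n : ℕ) (d : ℝ) : ℕ → MatchingSpace (2 * n)
  | 0 => stdVec n
  | r + 1 => d • gramPartial n d r + evenJM n (r + 1) (gramPartial n d r)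

theorem gramPartial_apply (d : ℝ) (r : ℕ) : ∀ (_ : r < n) (m : Matchings (2 * n)),
    (AgreesFrom (r + 1) m → ∃ t, loopCount m (stdMatching n) = t + 1 + (n - 1 - r) ∧
      gramPartial n d r m = d ^ t) ∧
    (¬ AgreesFrom (r + 1) m → gramPartial n d r m = 0) := by
  induction r with
  | zero =>
    intro hn m
    refine ⟨fun h => ⟨0, ?_, ?_⟩, fun h => ?_⟩
    · rw [h.eq_stdMatching, loopCount_stdMatching]
      omega
    · rw [h.eq_stdMatching]
      simp [gramPartial, stdVec]
    · rw [gramPartial, stdVec, PiLp.single_apply, if_neg]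
      rintro rfl
      exact h fun k _ hk => stdMatching_even (by omega)
  | succ r ih =>
    intro hr m
    have hrec : gramPartial n d (r + 1) m = d * gramPartial n d r m +
        ∑ i ∈ Iio (⟨2 * (r + 1), by omega⟩ : Fin (2 * n)),
          gramPartial n d r (Equiv.swap i ⟨2 * (r + 1), by omega⟩ • m) := by
      rw [← evenJM_apply hr]
      rfl
    set K : Fin (2 * n) := ⟨2 * (r + 1), by omega⟩ with hK
    set K' : Fin (2 * n) := ⟨2 * (r + 1) + 1, by omega⟩ with hK'
    have hKK' : K' ≠ K := Fin.ne_of_val_ne (by simp [hK, hK'])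
    have split : ∀ q : Matchings (2 * n), AgreesFrom (r + 1) q ↔
        AgreesFrom (r + 1 + 1) q ∧ q.1 K' = K := by
      intro q
      refine ⟨fun h => ⟨h.mono (by omega), h.odd le_rfl hr⟩, fun h k hk hkn => ?_⟩
      rcases hk.eq_or_lt with rfl | hk
      · change q.1 K = K'
        rw [← h.2, Matchings.apply_apply]
      · exact h.1 k hk hkn
    have hswap : ∀ i ∈ Iio K, (AgreesFrom (r + 1) (Equiv.swap i K • m) ↔
        AgreesFrom (r + 1 + 1) m ∧ m.1 K' = i) := by
      intro i hi
      have hi : (i : ℕ) < 2 * (r + 1) := Fin.lt_def.1 (mem_Iio.1 hi)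
      have hiK' : K' ≠ i := Fin.ne_of_val_ne (by simp only [hK']; omega)
      rw [split, AgreesFrom.swap_smul_iff i K (by omega) (by simp only [hK]; omega),
        Matchings.swap_smul_apply, Equiv.swap_apply_of_ne_of_ne hiK' hKK']
      refine and_congr_right fun _ => ?_
      rw [Equiv.swap_apply_eq_iff, Equiv.swap_apply_right]
    rw [hrec]
    constructor
    · intro h
      have hlt : (m.1 K' : ℕ) < 2 * (r + 1 + 1) := h.apply_lt (by simp only [hK']; omega)
      have hne : (m.1 K' : ℕ) ≠ K' := fun e => m.apply_ne _ (Fin.ext e)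
      by_cases hj : m.1 K' = K
      · obtain ⟨t, ht, ht'⟩ := (ih (by omega) m).1 ((split m).2 ⟨h, hj⟩)
        refine ⟨t + 1, by omega, ?_⟩
        rw [ht', sum_eq_zero, add_zero, pow_succ']
        intro i hi
        refine (ih (by omega) _).2 fun h' => ?_
        have := ((hswap i hi).1 h').2
        rw [hj] at this
        exact (mem_Iio.1 hi).ne this.symm
      · have hjK : m.1 K' ∈ Iio K := by
          rw [mem_Iio, Fin.lt_def]
          have : (m.1 K' : ℕ) ≠ K := fun e => hj (Fin.ext e)
          simp only [hK, hK'] at *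
          omega
        have hag := (hswap _ hjK).2 ⟨h, rfl⟩
        obtain ⟨t, ht, ht'⟩ := (ih (by omega) _).1 hag
        have hnot : K ∉ block (Equiv.swap (m.1 K') K • m) (stdMatching n) (m.1 K') := by
          rw [mem_block_comm, hag.block_pair le_rfl hr, mem_insert, mem_singleton, not_or]
          exact ⟨hj, m.apply_ne _⟩
        have hloop := loopCount_swap_smul_add_one hnot
        rw [swap_smul_swap_smul] at hloop
        refine ⟨t, by omega, ?_⟩
        rw [(ih (by omega) m).2 fun h' => hj ((split m).1 h').2, sum_eq_single _ ?_ ?_, ht']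
        · ring
        · intro i hi hij
          exact (ih (by omega) _).2 fun h' => hij ((hswap i hi).1 h').2.symm
        · exact fun h' => (h' hjK).elim
    · intro h
      rw [(ih (by omega) m).2 fun h' => h ((split m).1 h').1, sum_eq_zero, mul_zero, add_zero]
      intro i hi
      exact (ih (by omega) _).2 fun h' => h ((hswap i hi).1 h').1

theorem one_le_loopCount {N : ℕ} (hN : 0 < N) (m p : Matchings N) : 1 ≤ loopCount m p := by
  rw [loopCount_eq_card_blocks, Nat.succ_le_iff, card_pos]
  exact ⟨_, block_mem_blocks (x := ⟨0, hN⟩)⟩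

theorem gramPartial_last (hn : 0 < n) (d : ℝ) (m : Matchings (2 * n)) :
    gramPartial n d (n - 1) m = d ^ (loopCount m (stdMatching n) - 1) := by
  obtain ⟨t, ht, ht'⟩ := (gramPartial_apply d (n - 1) (by omega) m).1 fun k hk hkn => by omega
  rw [ht', ht]
  congr 1
  omega

end GramProduct

section CompleteHomogeneous

open Finset Nat

variable {n : ℕ}

theorem halfSize_eq_of_mem {N : ℕ} {m p : Matchings N} {x y : Fin N} (h : y ∈ block m p x) :
    halfSize m p y = halfSize m p x := by
  rw [halfSize, halfSize, block_eq_of_mem h]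

theorem AgreesFrom.halfSize_pair {r k : ℕ} {m : Matchings (2 * n)} (h : AgreesFrom r m)
    (hr : r ≤ k) (hk : k < n) : halfSize m (stdMatching n) ⟨2 * k, by omega⟩ = 1 := by
  rw [halfSize, h.block_pair hr hk, card_pair (Fin.ne_of_val_ne (by simp))]
  norm_num

theorem AgreesFrom.halfSize_eq_one {r : ℕ} {m : Matchings (2 * n)} (h : AgreesFrom r m)
    {x : Fin (2 * n)} (hx : 2 * r ≤ (x : ℕ)) : halfSize m (stdMatching n) x = 1 := by
  have hx2 := x.2
  have hk : (x : ℕ) / 2 < n := by omega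
  have hr : r ≤ (x : ℕ) / 2 := by omega
  rw [← h.halfSize_pair hr hk]
  refine halfSize_eq_of_mem ?_
  rw [h.block_pair hr hk, mem_insert, mem_singleton]
  rcases Nat.even_or_odd' (x : ℕ) with ⟨k, hk | hk⟩
  · exact Or.inl (Fin.ext (by simp only; omega))
  · exact Or.inr (Fin.ext (by simp only; omega))

/-- The positions below the `k`-th pair split off its block and the pairs above. -/
theorem AgreesFrom.sum_univ {k : ℕ} {m : Matchings (2 * n)} (h : AgreesFrom (k + 1) m)
    (hk : k < n) (f : Fin (2 * n) → ℝ) :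
    ∑ x, f x = ∑ x ∈ (Iio (⟨2 * k, by omega⟩ : Fin (2 * n))).filter
        (fun x => x ∉ block m (stdMatching n) ⟨2 * k, by omega⟩), f x +
      ∑ x ∈ block m (stdMatching n) ⟨2 * k, by omega⟩, f x +
      ∑ x ∈ Ioi (⟨2 * k + 1, by omega⟩ : Fin (2 * n)), f x := by
  set K : Fin (2 * n) := ⟨2 * k, by omega⟩ with hK
  set K' : Fin (2 * n) := ⟨2 * k + 1, by omega⟩ with hK'
  have hsub : ∀ x ∈ block m (stdMatching n) K, (x : ℕ) < 2 * (k + 1) := by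
    have hst : AgreesFrom (k + 1) (stdMatching n) := fun k _ hk => stdMatching_even (by omega)
    have : block m (stdMatching n) K ⊆ univ.filter fun x => (x : ℕ) < 2 * (k + 1) := by
      refine block_subset (fun x hx => ?_) ?_
      · rw [mem_filter] at hx ⊢
        rw [mem_filter]
        exact ⟨⟨mem_univ _, h.apply_lt hx.2⟩, mem_univ _, hst.apply_lt hx.2⟩
      · rw [mem_filter]
        exact ⟨mem_univ _, by simp only [hK]; omega⟩
    intro x hx
    exact (mem_filter.1 (this hx)).2
  have hK'mem : K' ∈ block m (stdMatching n) K := by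
    have := (isStable_block (m := m) (p := stdMatching n) K mem_block_self).2
    rwa [hK, stdMatching_even] at this
  rw [← sum_union, ← sum_union]
  · refine sum_congr ?_ fun _ _ => rfl
    symm
    rw [eq_univ_iff_forall]
    intro x
    rw [mem_union, mem_union, mem_filter, mem_Iio, mem_Ioi, Fin.lt_def, Fin.lt_def]
    by_cases hx : x ∈ block m (stdMatching n) K
    · exact Or.inl (Or.inr hx)
    · have h1 : (x : ℕ) ≠ K := fun e => hx (Fin.ext e ▸ mem_block_self)
      have h2 : (x : ℕ) ≠ K' := fun e => hx (Fin.ext e ▸ hK'mem)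
      simp only [hK, hK'] at h1 h2
      rcases (by omega : (x : ℕ) < 2 * k ∨ 2 * k + 1 < (x : ℕ)) with h3 | h3
      · exact Or.inl (Or.inl ⟨h3, hx⟩)
      · exact Or.inr h3
  · rw [disjoint_union_left]
    refine ⟨disjoint_left.2 fun x hx hx' => ?_, disjoint_left.2 fun x hx hx' => ?_⟩
    · have h1 := Fin.lt_def.1 (mem_Iio.1 (mem_filter.1 hx).1)
      have h2 := Fin.lt_def.1 (mem_Ioi.1 hx')
      simp only [hK, hK'] at h1 h2
      omega
    · have h1 := hsub x hx
      have h2 := Fin.lt_def.1 (mem_Ioi.1 hx')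
      simp only [hK'] at h2
      omega
  · exact disjoint_left.2 fun x hx hx' => (mem_filter.1 hx).2 hx'

variable {k : ℕ} {m : Matchings (2 * n)}

theorem AgreesFrom.card_outside (h : AgreesFrom (k + 1) m) (hk : k < n) :
    (#((Iio (⟨2 * k, by omega⟩ : Fin (2 * n))).filter
        (fun x => x ∉ block m (stdMatching n) ⟨2 * k, by omega⟩)) : ℝ) =
      2 * ((k + 1) - halfSize m (stdMatching n) ⟨2 * k, by omega⟩) := by
  have key := h.sum_univ hk fun _ => 1
  have h1 : (#(Ioi (⟨2 * k + 1, by omega⟩ : Fin (2 * n))) : ℝ) = 2 * n - 2 * k - 2 := by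
    rw [Fin.card_Ioi]
    have : 2 * n - 1 - (2 * k + 1) + 2 * k + 2 = 2 * n := by omega
    have := congrArg (Nat.cast : ℕ → ℝ) this
    push_cast at this ⊢
    linarith
  simp only [sum_const, nsmul_eq_mul, mul_one, Finset.card_univ, Fintype.card_fin] at key
  rw [h1] at key
  rw [halfSize]
  push_cast at key
  linarith

theorem AgreesFrom.sum_inv_outside (h : AgreesFrom (k + 1) m) (hk : k < n) :
    ∑ x ∈ (Iio (⟨2 * k, by omega⟩ : Fin (2 * n))).filter
        (fun x => x ∉ block m (stdMatching n) ⟨2 * k, by omega⟩),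
          (halfSize m (stdMatching n) x)⁻¹ =
      2 * (loopCount m (stdMatching n) + k - n) := by
  have key := h.sum_univ hk fun x => (halfSize m (stdMatching n) x)⁻¹
  have h1 : (#(Ioi (⟨2 * k + 1, by omega⟩ : Fin (2 * n))) : ℝ) = 2 * n - 2 * k - 2 := by
    rw [Fin.card_Ioi]
    have : 2 * n - 1 - (2 * k + 1) + 2 * k + 2 = 2 * n := by omega
    have := congrArg (Nat.cast : ℕ → ℝ) this
    push_cast at this ⊢
    linarith
  have h2 : ∑ x ∈ block m (stdMatching n) ⟨2 * k, by omega⟩,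
      (halfSize m (stdMatching n) x)⁻¹ = 2 := by
    rw [sum_congr rfl fun x hx => by rw [halfSize_eq_of_mem hx], sum_const, nsmul_eq_mul]
    have := halfSize_pos (m := m) (p := stdMatching n) (x := ⟨2 * k, by omega⟩)
    rw [← div_eq_mul_inv, div_eq_iff this.ne', halfSize]
    ring
  have h3 : ∑ x ∈ Ioi (⟨2 * k + 1, by omega⟩ : Fin (2 * n)),
      (halfSize m (stdMatching n) x)⁻¹ = 2 * n - 2 * k - 2 := by
    rw [← h1, sum_congr rfl fun x hx => by
      rw [h.halfSize_eq_one (x := x) (Fin.lt_def.1 (mem_Ioi.1 hx))]]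
    simp
  rw [sum_inv_halfSize, h2, h3] at key
  linarith

theorem blockWeight_eq_halfSize {N : ℕ} {m p : Matchings N} (h : loopCount m p = 1) (x : Fin N) :
    blockWeight m p = halfSize m p x := by
  rw [loopCount_eq_card_blocks, card_eq_one] at h
  obtain ⟨C, hC⟩ := h
  have hx : block m p x ∈ blocks m p := block_mem_blocks
  rw [hC, mem_singleton] at hx
  rw [blockWeight, hC, prod_singleton, halfSize, hx]

theorem blockWeight_stdMatching : blockWeight (stdMatching n) (stdMatching n) = 1 := by
  have hst : AgreesFrom 0 (stdMatching n) := fun k _ hk => stdMatching_even (by omega)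
  refine prod_eq_one fun C hC => ?_
  obtain ⟨x, -, rfl⟩ := mem_image.1 hC
  exact hst.halfSize_eq_one (by omega)

/-- The complete homogeneous polynomial of degree `j` in the last `M` even Jucys–Murphy elements,
applied to the indicator of the matchings forming a single loop with the standard one. -/
noncomputable def homogeneousJM (n : ℕ) : ℕ → ℕ → MatchingSpace (2 * n)
  | 0, 0 => gramPartial n 0 (n - 1)
  | 0, _ + 1 => 0
  | M + 1, 0 => homogeneousJM n M 0
  | M + 1, j + 1 => homogeneousJM n M (j + 1) + evenJM n (n - 1 - M) (homogeneousJM n (M + 1) j)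

theorem homogeneousJM_zero_right (M : ℕ) : homogeneousJM n M 0 = gramPartial n 0 (n - 1) := by
  induction M with
  | zero => rw [homogeneousJM]
  | succ M ih => rw [homogeneousJM, ih]

theorem homogeneousJM_succ_succ (hn : 0 < n) (M j : ℕ) (m : Matchings (2 * n)) :
    homogeneousJM n (M + 1) (j + 1) m = homogeneousJM n M (j + 1) m +
      ∑ i ∈ Iio (⟨2 * (n - 1 - M), by omega⟩ : Fin (2 * n)),
        homogeneousJM n (M + 1) j (Equiv.swap i ⟨2 * (n - 1 - M), by omega⟩ • m) := by
  rw [← evenJM_apply (by omega), homogeneousJM]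
  rfl

theorem loopCount_le_swap_smul_add_one {N : ℕ} (a b : Fin N) (m p : Matchings N) :
    loopCount m p ≤ loopCount (Equiv.swap a b • m) p + 1 := by
  by_cases h : b ∈ block m p a
  · exact (loopCount_le_swap_smul h).trans (Nat.le_succ _)
  · exact (loopCount_swap_smul_add_one h).ge

theorem homogeneousJM_eq_zero (hn : 0 < n) (M : ℕ) : ∀ (j : ℕ) (m : Matchings (2 * n)),
    j + 1 < loopCount m (stdMatching n) → homogeneousJM n M j m = 0 := by
  induction M with
  | zero =>
    rintro (_ | j) m h
    · rw [homogeneousJM, gramPartial_last hn, zero_pow (by omega)]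
    · rw [homogeneousJM]
      rfl
  | succ M ih =>
    intro j
    induction j with
    | zero =>
      intro m h
      rw [homogeneousJM]
      exact ih 0 m h
    | succ j ihj =>
      intro m h
      rw [homogeneousJM_succ_succ hn, ih _ _ h, zero_add]
      refine sum_eq_zero fun i _ => ihj _ ?_
      have := loopCount_le_swap_smul_add_one i ⟨2 * (n - 1 - M), by omega⟩ m (stdMatching n)
      omega

/-- The scalar factor in the leading values of `homogeneousJM`. -/
noncomputable def leadingFactor (n M : ℕ) : ℝ := (n + M - 1)! / (n ! * (2 * M + 1)!)

theorem homogeneousJM_leading_step (hn : 0 < n) {M : ℕ} (hM : M < n)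
    (hP : ∀ (L : ℕ) (m : Matchings (2 * n)), AgreesFrom (n - M) m →
      loopCount m (stdMatching n) = L + 2 → homogeneousJM n M (L + 1) m =
        2 ^ (L + 1) * blockWeight m (stdMatching n) * (L + M)! * leadingFactor n M *
          (2 * M * (2 * M + 1))) (L : ℕ) :
    ∀ m : Matchings (2 * n), AgreesFrom (n - M) m → loopCount m (stdMatching n) = L + 1 →
      homogeneousJM n (M + 1) L m * halfSize m (stdMatching n) ⟨2 * (n - 1 - M), by omega⟩ =
        2 ^ L * blockWeight m (stdMatching n) * (L + M)! * leadingFactor n M *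
          (2 * M * halfSize m (stdMatching n) ⟨2 * (n - 1 - M), by omega⟩ + (n - M)) := by
  obtain ⟨k, hk⟩ : ∃ k, n = k + 1 + M := ⟨n - 1 - M, by omega⟩
  have hkn : n - M = k + 1 := by omega
  have hkn' : n - 1 - M = k := by omega
  have hkr : (n : ℝ) = k + 1 + M := by rw [hk]; push_cast; ring
  rw [hkn] at hP
  rw [hkn]
  simp only [hkn']
  have hk' : k < n := by omega
  induction L with
  | zero =>
    intro m hm hl
    have h1 := hm.sum_inv_outside hk'
    have h2 : 0 ≤ (2 : ℝ) * (loopCount m (stdMatching n) + k - n) := by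
      rw [← h1]
      exact sum_nonneg fun x _ => inv_nonneg.2 halfSize_pos.le
    have hM0 : M = 0 := by
      rw [hl, hkr] at h2
      have : (M : ℝ) ≤ 0 := by push_cast at h2; linarith
      exact Nat.le_zero.1 (by exact_mod_cast this)
    subst hM0
    rw [homogeneousJM_zero_right, gramPartial_last hn, hl,
      blockWeight_eq_halfSize hl ⟨2 * k, by omega⟩, leadingFactor]
    have h3 : (((n - 1)! : ℕ) : ℝ) ≠ 0 := by positivity
    have h4 : (n : ℝ) ≠ 0 := by positivity
    rw [← Nat.mul_factorial_pred hn.ne']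
    push_cast
    simp
    field_simp
  | succ L ih =>
    intro m hm hl
    set K : Fin (2 * n) := ⟨2 * k, by omega⟩ with hK
    set s := halfSize m (stdMatching n) K with hs
    have hs0 : 0 < s := halfSize_pos
    have hrec : homogeneousJM n (M + 1) (L + 1) m = homogeneousJM n M (L + 1) m +
        ∑ i ∈ Iio K, homogeneousJM n (M + 1) L (Equiv.swap i K • m) := by
      rw [homogeneousJM_succ_succ hn]
      simp only [hkn', hK]
    have hterm : ∀ i ∈ Iio K, i ∉ block m (stdMatching n) K →
        homogeneousJM n (M + 1) L (Equiv.swap i K • m) * s =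
          2 ^ L * blockWeight m (stdMatching n) * (L + M)! * leadingFactor n M *
            ((2 * M * s + (n - M)) * (halfSize m (stdMatching n) i)⁻¹ + 2 * M) := by
      intro i hi hiK
      have hi' : (i : ℕ) < 2 * k := Fin.lt_def.1 (mem_Iio.1 hi)
      have hl' := loopCount_swap_smul_add_one hiK
      have hag : AgreesFrom (k + 1) (Equiv.swap K i • m) :=
        (AgreesFrom.swap_smul_iff K i (by simp only [hK]; omega) (by omega)).2 hm
      have e1 := ih _ hag (by omega)
      have e2 := blockWeight_swap_smul hiK
      have hi0 : 0 < halfSize m (stdMatching n) i := halfSize_pos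
      rw [halfSize_swap_smul hiK, ← hs] at e1
      rw [← hs] at e2
      rw [Equiv.swap_comm i K]
      have e3 : blockWeight (Equiv.swap K i • m) (stdMatching n) =
          blockWeight m (stdMatching n) * (s + halfSize m (stdMatching n) i) /
            (s * halfSize m (stdMatching n) i) := by
        rw [eq_div_iff (by positivity), e2]
      rw [e3] at e1
      have e4 : (s + halfSize m (stdMatching n) i) ≠ 0 := by positivity
      rw [← mul_right_inj' e4]
      calc _ = s * (homogeneousJM n (M + 1) L (Equiv.swap K i • m) *
              (s + halfSize m (stdMatching n) i)) := by ring
        _ = _ := by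
          rw [e1]
          field_simp
          ring
    have hsum : (∑ i ∈ Iio K, homogeneousJM n (M + 1) L (Equiv.swap i K • m)) * s =
        2 ^ L * blockWeight m (stdMatching n) * (L + M)! * leadingFactor n M *
          ((2 * M * s + (n - M)) * (2 * (L + 1 - M)) + 2 * M * (2 * (k + 1 - s))) := by
      have h1 := hm.sum_inv_outside hk'
      have h2 := hm.card_outside hk'
      rw [← hK] at h1
      rw [← hK, ← hs] at h2
      rw [← sum_filter_add_sum_filter_not (Iio K) (fun x => x ∉ block m (stdMatching n) K)]
      rw [sum_eq_zero (s := (Iio K).filter fun x => ¬ x ∉ block m (stdMatching n) K), add_zero,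
        sum_mul, sum_congr rfl fun i hi => hterm i (mem_filter.1 hi).1 (mem_filter.1 hi).2,
        ← mul_sum, sum_add_distrib, ← mul_sum, h1, sum_const, nsmul_eq_mul, h2, hl, hkr]
      · push_cast
        ring
      · intro i hi
        refine homogeneousJM_eq_zero hn _ _ _ ?_
        rw [Equiv.swap_comm]
        have := loopCount_le_swap_smul (not_not.1 (mem_filter.1 hi).2)
        omega
    rw [hrec, add_mul, hsum, hP L m hm (by omega), show L + 1 + M = L + M + 1 by ring,
      Nat.factorial_succ, hkr]
    push_cast
    ring

theorem homogeneousJM_leading (hn : 0 < n) (M : ℕ) (hM : M < n) :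
    ∀ (L : ℕ) (m : Matchings (2 * n)), AgreesFrom (n - M) m →
      loopCount m (stdMatching n) = L + 2 → homogeneousJM n M (L + 1) m =
        2 ^ (L + 1) * blockWeight m (stdMatching n) * (L + M)! * leadingFactor n M *
          (2 * M * (2 * M + 1)) := by
  induction M with
  | zero =>
    intro L m _ _
    rw [homogeneousJM]
    simp
  | succ M ih =>
    intro L m hm hl
    have h := homogeneousJM_leading_step hn (by omega) (ih (by omega)) (L + 1) m
      (hm.mono (by omega)) hl
    rw [hm.halfSize_pair (k := n - 1 - M) (by omega) (by omega), mul_one, mul_one] at h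
    rw [h, leadingFactor, leadingFactor, show n + (M + 1) - 1 = n + M - 1 + 1 by omega,
      Nat.factorial_succ (n + M - 1), show 2 * (M + 1) + 1 = 2 * M + 1 + 1 + 1 by ring,
      Nat.factorial_succ (2 * M + 1 + 1), Nat.factorial_succ (2 * M + 1),
      show L + 1 + M = L + (M + 1) by ring, show n + M - 1 + 1 = n + M by omega]
    have h1 : ((n ! : ℕ) : ℝ) ≠ 0 := by positivity
    have h2 : (((2 * M + 1)! : ℕ) : ℝ) ≠ 0 := by positivity
    push_cast
    field_simp
    ring

theorem homogeneousJM_stdMatching_of_lt {j : ℕ} (hj : j < n - 1) :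
    homogeneousJM n (n - 1) j (stdMatching n) = 0 :=
  homogeneousJM_eq_zero (by omega) _ _ _ (by rw [loopCount_stdMatching]; omega)

theorem homogeneousJM_stdMatching (hn : 2 ≤ n) :
    homogeneousJM n (n - 1) (n - 1) (stdMatching n) =
      2 ^ (n - 1) * (n - 1)! * catalan (n - 1) := by
  obtain ⟨n, rfl⟩ : ∃ k, n = k + 2 := ⟨n - 2, by omega⟩
  have hst : AgreesFrom (n + 2 - (n + 2 - 1)) (stdMatching (n + 2)) :=
    fun k _ hk => stdMatching_even (by omega)
  have h := homogeneousJM_leading (by omega) (n + 2 - 1) (by omega) n _ hst loopCount_stdMatching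
  have h1 : ((n + 1 + 1) * catalan (n + 1) * ((n + 1)! * (n + 1)!) : ℝ) = (2 * (n + 1))! := by
    have h1 := _root_.succ_mul_catalan_eq_centralBinom (n + 1)
    have h2 := Nat.choose_mul_factorial_mul_factorial (by omega : n + 1 ≤ 2 * (n + 1))
    rw [← Nat.centralBinom_eq_two_mul_choose, ← h1, show 2 * (n + 1) - (n + 1) = n + 1 by omega]
      at h2
    exact_mod_cast (mul_assoc _ _ _).symm.trans h2
  rw [show n + 2 - 1 = n + 1 by omega] at *
  rw [h, blockWeight_stdMatching, leadingFactor, show n + 2 + (n + 1) - 1 = 2 * (n + 1) by omega,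
    Nat.factorial_succ (2 * (n + 1)), Nat.factorial_succ (n + 1)]
  have e : (2 * (n + 1))! = (2 * n + 1 + 1) * (n + (n + 1))! := by
    rw [show 2 * (n + 1) = 2 * n + 1 + 1 by ring, Nat.factorial_succ,
      show n + (n + 1) = 2 * n + 1 by ring]
  have h2 : (((n + 1)! : ℕ) : ℝ) ≠ 0 := by positivity
  have h3 : (((2 * (n + 1))! : ℕ) : ℝ) ≠ 0 := by positivity
  have e' : (((2 * (n + 1))! : ℕ) : ℝ) = (2 * n + 1 + 1) * ((n + (n + 1))! : ℕ) := by
    exact_mod_cast e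
  push_cast
  field_simp
  linear_combination -e' - h1

end CompleteHomogeneous

section Decomposition

open Finset

variable {N n : ℕ}

theorem matchingRep_single (σ : Equiv.Perm (Fin N)) (p : Matchings N) :
    matchingRep σ (EuclideanSpace.single p 1) = EuclideanSpace.single (σ • p) (1 : ℝ) := by
  ext m
  rw [matchingRep_apply, PiLp.single_apply, PiLp.single_apply]
  simp only [inv_smul_eq_iff]

theorem Matchings.swap_smul_eq_swap_apply_smul {p : Matchings N} {a b : Fin N}
    (h : [a, b, p.1 a, p.1 b].Nodup) :
    Equiv.swap a b • p = Equiv.swap (p.1 a) (p.1 b) • p := by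
  rw [Matchings.smul_eq_iff]
  intro x
  have hcomm := (Equiv.Perm.disjoint_swap_swap h).commute
  have e1 : ∀ z, p.1 (Equiv.swap (p.1 a) (p.1 b) z) = Equiv.swap a b (p.1 z) := by
    intro z
    rw [p.1.injective.map_swap, p.apply_apply, p.apply_apply]
  have e2 : ∀ z, p.1 (Equiv.swap a b z) = Equiv.swap (p.1 a) (p.1 b) (p.1 z) :=
    fun z => p.1.injective.map_swap _ _ _
  have e3 : ∀ z, Equiv.swap a b (Equiv.swap (p.1 a) (p.1 b) z) =
      Equiv.swap (p.1 a) (p.1 b) (Equiv.swap a b z) := fun z => Equiv.congr_fun hcomm z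
  rw [Matchings.swap_smul_apply, e1, e2, e3, Equiv.swap_apply_self]

theorem swap_pair_smul_stdMatching {k : ℕ} (hk : k < n) :
    Equiv.swap (⟨2 * k, by omega⟩ : Fin (2 * n)) ⟨2 * k + 1, by omega⟩ • stdMatching n =
      stdMatching n := by
  have h : Equiv.swap (⟨2 * k, by omega⟩ : Fin (2 * n)) ⟨2 * k + 1, by omega⟩ • stdMatching n =
      Equiv.swap ⟨2 * k, by omega⟩ ((stdMatching n).1 ⟨2 * k, by omega⟩) • stdMatching n := by
    rw [stdMatching_even]
  rw [h, Matchings.smul_eq_iff]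
  generalize (⟨2 * k, by omega⟩ : Fin (2 * n)) = K
  intro x
  rw [(stdMatching n).1.injective.map_swap, Matchings.apply_apply, Equiv.swap_comm]

theorem swap_pair_jucysMurphy_stdVec {k : ℕ} (hk : k < n) :
    matchingRep (Equiv.swap (⟨2 * k, by omega⟩ : Fin (2 * n)) ⟨2 * k + 1, by omega⟩)
      (jucysMurphy ⟨2 * k, by omega⟩ (stdVec n)) = jucysMurphy ⟨2 * k, by omega⟩ (stdVec n) := by
  have hfix := swap_pair_smul_stdMatching hk
  have hK' := stdMatching_odd (n := n) (k := k) (by omega)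
  set K : Fin (2 * n) := ⟨2 * k, by omega⟩ with hK
  set K' : Fin (2 * n) := ⟨2 * k + 1, by omega⟩ with hK'def
  have hKK : K ≠ K' := Fin.ne_of_val_ne (by simp [hK, hK'def])
  have hst : AgreesFrom k (stdMatching n) := fun k _ hk => stdMatching_even (by omega)
  have hmem : ∀ i ∈ Iio K, (stdMatching n).1 i ∈ Iio K := by
    intro i hi
    rw [mem_Iio, Fin.lt_def] at hi ⊢
    exact hst.apply_lt hi
  have hterm : ∀ i ∈ Iio K, Equiv.swap K K' • Equiv.swap i K • stdMatching n =
      Equiv.swap ((stdMatching n).1 i) K • stdMatching n := by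
    intro i hi
    have hi1 : i ≠ K := (mem_Iio.1 hi).ne
    have hi2 : i ≠ K' := Fin.ne_of_val_ne (by
      have := Fin.lt_def.1 (mem_Iio.1 hi)
      simp only [hK, hK'def] at this ⊢
      omega)
    have hj := hmem i hi
    have hj1 : (stdMatching n).1 i ≠ K := (mem_Iio.1 hj).ne
    have hj2 : (stdMatching n).1 i ≠ K' := Fin.ne_of_val_ne (by
      have := Fin.lt_def.1 (mem_Iio.1 hj)
      simp only [hK, hK'def] at this ⊢
      omega)
    have hij : (stdMatching n).1 i ≠ i := (stdMatching n).apply_ne i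
    have e : Equiv.swap K K' * Equiv.swap i K = Equiv.swap i K' * Equiv.swap K K' := by
      have h := Equiv.swap_apply_apply (Equiv.swap K K') i K
      rw [Equiv.swap_apply_left, Equiv.swap_apply_of_ne_of_ne hi1 hi2] at h
      rw [h]
      group
    rw [← mul_smul, e, mul_smul, hfix, Matchings.swap_smul_eq_swap_apply_smul, hK']
    rw [hK']
    simp only [List.nodup_cons, List.mem_cons, List.not_mem_nil, or_false, not_or,
      List.nodup_nil, not_false_iff, and_true]
    exact ⟨⟨hi2, hij.symm, hi1⟩, ⟨hj2.symm, hKK.symm⟩, hj1⟩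
  simp only [jucysMurphy, LinearMap.sum_apply, map_sum, stdVec, matchingRep_single]
  refine sum_nbij' (fun i => (stdMatching n).1 i) (fun i => (stdMatching n).1 i) hmem hmem
    (fun i _ => Matchings.apply_apply _ _) (fun i _ => Matchings.apply_apply _ _) fun i hi => ?_
  rw [hterm i hi]

theorem jucysMurphy_odd_stdVec {k : ℕ} (hk : k < n) :
    jucysMurphy ⟨2 * k + 1, by omega⟩ (stdVec n) =
      jucysMurphy ⟨2 * k, by omega⟩ (stdVec n) + stdVec n := by
  have h := LinearMap.congr_fun (jucysMurphy_succ_mul_swap (N := 2 * n) (i := ⟨2 * k, by omega⟩)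
    (j := ⟨2 * k + 1, by omega⟩) rfl) (stdVec n)
  simp only [Module.End.mul_apply, LinearMap.add_apply, Module.End.one_apply] at h
  rw [swap_pair_jucysMurphy_stdVec hk] at h
  rw [← h]
  congr 1
  rw [stdVec, matchingRep_single, swap_pair_smul_stdMatching hk]

/-- Joint eigenvectors with distinct contents are independent. -/
theorem eq_zero_of_sum_eigenvectors {s : Finset (Fin N → ℝ)} {u : (Fin N → ℝ) → MatchingSpace N}
    (hu : ∀ a ∈ s, ∀ q, jucysMurphy q (u a) = a q • u a) (h0 : ∑ a ∈ s, u a = 0) :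
    ∀ a ∈ s, u a = 0 := by
  intro a ha
  have h : inner ℝ (u a) (∑ b ∈ s, u b) = 0 := by rw [h0, inner_zero_right]
  rw [inner_sum, sum_eq_single a] at h
  · exact inner_self_eq_zero.1 h
  · intro b hb hba
    obtain ⟨q, hq⟩ := Function.ne_iff.1 hba
    have := isSymmetric_jucysMurphy q (u a) (u b)
    rw [hu a ha, hu b hb, inner_smul_left, inner_smul_right] at this
    simp only [conj_trivial] at this
    have h2 : (b q - a q) * inner ℝ (u a) (u b) = 0 := by linarith
    exact (mul_eq_zero.1 h2).resolve_left (sub_ne_zero.2 hq)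
  · exact fun hs => (hs ha).elim

/-- The coordinate vector of the standard matching is a sum of joint eigenvectors whose contents
come from partitions with doubled rows. -/
theorem exists_doubled_decomposition (n : ℕ) :
    ∃ (s : Finset (Fin (2 * n) → ℝ)) (c : (Fin (2 * n) → ℝ) → ℕ → ℤ)
      (v : (Fin (2 * n) → ℝ) → MatchingSpace (2 * n)),
      ∑ a ∈ s, v a = stdVec n ∧
      (∀ a ∈ s, ∀ q, jucysMurphy q (v a) = a q • v a) ∧
      (∀ a ∈ s, IsDoubled n (c a)) ∧ ∀ a ∈ s, ∀ q : Fin (2 * n), (c a q : ℝ) = a q := by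
  have htop := LinearMap.IsSymmetric.iSup_iInf_eq_top_of_commute
    (T := fun q : Fin (2 * n) => jucysMurphy q) isSymmetric_jucysMurphy
    (fun p q _ => commute_jucysMurphy p q)
  have hmem : stdVec n ∈
      ⨆ χ : Fin (2 * n) → ℝ, ⨅ i, Module.End.eigenspace (jucysMurphy i) (χ i) := by
    rw [htop]
    trivial
  rw [Submodule.mem_iSup_iff_exists_finsupp] at hmem
  obtain ⟨v, hv, hsum⟩ := hmem
  have hv : ∀ a q, jucysMurphy q (v a) = a q • v a := fun a q =>
    Module.End.mem_eigenspace_iff.1 ((Submodule.mem_iInf _).1 (hv a) q)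
  have hcv : ∀ a ∈ v.support, IsContentVector a (v a) := fun a ha =>
    ⟨Finsupp.mem_support_iff.1 ha, hv a⟩
  have hint : ∀ a : Fin (2 * n) → ℝ, ∃ c : ℕ → ℤ, a ∈ v.support → ∀ q : Fin (2 * n),
      (c q : ℝ) = a q := by
    intro a
    by_cases ha : a ∈ v.support
    · have := fun q : Fin (2 * n) => (hcv a ha).exists_int q a _ q rfl
      choose z hz using this
      refine ⟨fun k => if h : k < 2 * n then z ⟨k, h⟩ else 0, fun _ q => ?_⟩
      simp only [q.2, dif_pos, hz]
    · exact ⟨0, fun h => (ha h).elim⟩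
  choose c hc using hint
  refine ⟨v.support, c, v, hsum, fun a _ => hv a, fun a ha => ?_, hc⟩
  have hca : (fun q : Fin (2 * n) => (c a q : ℝ)) = a := funext (hc a ha)
  refine ⟨fun q hq => isContentSet_contentSet.mayaStep q hq _
    ⟨v a, by rw [hca]; exact hcv a ha⟩, fun k hk => ?_⟩
  have hz := eq_zero_of_sum_eigenvectors (s := v.support)
    (u := fun a => (a ⟨2 * k + 1, by omega⟩ - a ⟨2 * k, by omega⟩ - 1) • v a)
    (fun a _ q => by rw [map_smul, hv, smul_comm]) (by
      have hstd := jucysMurphy_odd_stdVec hk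
      rw [← hsum, Finsupp.sum, map_sum, map_sum, ← sum_add_distrib, ← sub_eq_zero,
        ← sum_sub_distrib] at hstd
      rw [← hstd]
      refine sum_congr rfl fun a _ => ?_
      rw [hv, hv, sub_smul, sub_smul, one_smul]
      abel) a ha
  have h1 := (smul_eq_zero.1 hz).resolve_right (hcv a ha).1
  have e1 := hc a ha ⟨2 * k + 1, by omega⟩
  have e2 := hc a ha ⟨2 * k, by omega⟩
  simp only at e1 e2
  rw [← e1, ← e2] at h1
  have : (c a (2 * k + 1) : ℝ) = c a (2 * k) + 1 := by linarith
  exact_mod_cast this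

end Decomposition

section GramInverse

open Finset Matrix

variable {n : ℕ}

/-- The complete homogeneous symmetric polynomial of degree `j` in `x 0, …, x (M - 1)`. -/
def completeSum (x : ℕ → ℝ) : ℕ → ℕ → ℝ
  | 0, 0 => 1
  | 0, _ + 1 => 0
  | M + 1, 0 => completeSum x M 0
  | M + 1, j + 1 => completeSum x M (j + 1) + x M * completeSum x (M + 1) j

/-- The Gram matrix as an operator. -/
noncomputable def gramOp (d n : ℕ) : Module.End ℝ (MatchingSpace (2 * n)) :=
  Matrix.toLpLin 2 2 (GramO d n)

theorem gramOp_apply (d : ℕ) (f : MatchingSpace (2 * n)) (p : Matchings (2 * n)) :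
    gramOp d n f p = ∑ m, (d : ℝ) ^ loopCount p m * f m := rfl

theorem commute_gramOp_matchingRep (d : ℕ) (σ : Equiv.Perm (Fin (2 * n))) :
    Commute (gramOp d n) (matchingRep σ) := by
  refine LinearMap.ext fun f => ?_
  ext p
  change gramOp d n (matchingRep σ f) p = gramOp d n f (σ⁻¹ • p)
  rw [gramOp_apply, gramOp_apply]
  refine Fintype.sum_equiv (MulAction.toPerm σ⁻¹) _ _ fun m => ?_
  rw [MulAction.toPerm_apply, loopCount_smul, matchingRep_apply]

theorem commute_gramOp_jucysMurphy (d : ℕ) (q : Fin (2 * n)) :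
    Commute (gramOp d n) (jucysMurphy q) :=
  Commute.sum_right _ _ _ fun _ _ => commute_gramOp_matchingRep d _

theorem gramOp_stdVec (hn : 0 < n) (d : ℕ) :
    gramOp d n (stdVec n) = (d : ℝ) • gramPartial n d (n - 1) := by
  ext p
  rw [gramOp_apply, PiLp.smul_apply, gramPartial_last hn, smul_eq_mul, ← pow_succ',
    Nat.sub_add_cancel (one_le_loopCount (by omega) _ _), sum_eq_single (stdMatching n)]
  · simp [stdVec]
  · intro m _ hm
    rw [stdVec, PiLp.single_apply, if_neg hm, mul_zero]
  · simp

theorem sum_evenJM {k : ℕ} (hk : k < n) (f : MatchingSpace (2 * n)) :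
    ∑ m, evenJM n k f m = 2 * k * ∑ m, f m := by
  simp only [evenJM_apply hk]
  rw [sum_comm]
  have h : ∀ i ∈ Iio (⟨2 * k, by omega⟩ : Fin (2 * n)),
      ∑ m, f (Equiv.swap i ⟨2 * k, by omega⟩ • m) = ∑ m, f m := fun i _ =>
    Fintype.sum_equiv (MulAction.toPerm (Equiv.swap i ⟨2 * k, by omega⟩)) _ _ fun m => rfl
  rw [sum_congr rfl h, sum_const, Fin.card_Iio, nsmul_eq_mul]
  push_cast
  ring

theorem sum_gramPartial_zero (r : ℕ) (hr : r < n) :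
    ∑ m, gramPartial n 0 r m = 2 ^ r * r.factorial := by
  induction r with
  | zero => simp [gramPartial, stdVec]
  | succ r ih =>
    rw [gramPartial]
    simp only [zero_smul, zero_add]
    rw [sum_evenJM hr, ih (by omega), Nat.factorial_succ]
    push_cast
    ring

section Eigen

variable {s : Finset (Fin (2 * n) → ℝ)} {c : (Fin (2 * n) → ℝ) → ℕ → ℤ}
  {v : (Fin (2 * n) → ℝ) → MatchingSpace (2 * n)}

theorem evenJM_eigenvector (hv : ∀ a ∈ s, ∀ q, jucysMurphy q (v a) = a q • v a)
    (hc : ∀ a ∈ s, ∀ q : Fin (2 * n), (c a q : ℝ) = a q) {a : Fin (2 * n) → ℝ} (ha : a ∈ s)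
    {k : ℕ} (hk : k < n) : evenJM n k (v a) = (c a (2 * k) : ℝ) • v a := by
  rw [evenJM, dif_pos hk, hv a ha, ← hc a ha]

theorem gramPartial_eq_sum (hsum : ∑ a ∈ s, v a = stdVec n)
    (hv : ∀ a ∈ s, ∀ q, jucysMurphy q (v a) = a q • v a)
    (hc : ∀ a ∈ s, ∀ q : Fin (2 * n), (c a q : ℝ) = a q) (d : ℝ) (r : ℕ) (hr : r < n) :
    gramPartial n d r = ∑ a ∈ s, (∏ k ∈ Icc 1 r, (d + c a (2 * k))) • v a := by
  induction r with
  | zero => simp [gramPartial, hsum]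
  | succ r ih =>
    rw [gramPartial, ih (by omega), map_sum, smul_sum, ← sum_add_distrib]
    refine sum_congr rfl fun a ha => ?_
    rw [map_smul, evenJM_eigenvector hv hc ha hr, smul_smul, smul_smul, ← add_smul,
      prod_Icc_succ_top (by omega)]
    congr 1
    ring

theorem inner_gramPartial_zero (hv : ∀ a ∈ s, ∀ q, jucysMurphy q (v a) = a q • v a)
    (hc : ∀ a ∈ s, ∀ q : Fin (2 * n), (c a q : ℝ) = a q) {a : Fin (2 * n) → ℝ} (ha : a ∈ s)
    (r : ℕ) (hr : r < n) : inner ℝ (gramPartial n 0 r) (v a) =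
      (∏ k ∈ Icc 1 r, (c a (2 * k) : ℝ)) * v a (stdMatching n) := by
  induction r with
  | zero => simp [gramPartial, stdVec, EuclideanSpace.inner_single_left]
  | succ r ih =>
    have hsymm : (evenJM n (r + 1)).IsSymmetric := by
      rw [evenJM, dif_pos hr]
      exact isSymmetric_jucysMurphy _
    rw [gramPartial, zero_smul, zero_add, hsymm, evenJM_eigenvector hv hc ha hr,
      inner_smul_right, ih (by omega), prod_Icc_succ_top (by omega)]
    ring

theorem homogeneousJM_eq_sum (hn : 0 < n) (hsum : ∑ a ∈ s, v a = stdVec n)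
    (hv : ∀ a ∈ s, ∀ q, jucysMurphy q (v a) = a q • v a)
    (hc : ∀ a ∈ s, ∀ q : Fin (2 * n), (c a q : ℝ) = a q) (M : ℕ) :
    ∀ j, homogeneousJM n M j = ∑ a ∈ s, ((∏ k ∈ Icc 1 (n - 1), (c a (2 * k) : ℝ)) *
      completeSum (fun i => c a (2 * (n - 1 - i))) M j) • v a := by
  induction M with
  | zero =>
    rintro (_ | j)
    · rw [homogeneousJM, gramPartial_eq_sum hsum hv hc 0 _ (by omega)]
      simp [completeSum]
    · simp [homogeneousJM, completeSum]
  | succ M ih =>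
    intro j
    induction j with
    | zero =>
      rw [homogeneousJM, ih]
      simp only [completeSum]
    | succ j ihj =>
      rw [homogeneousJM, ih, ihj, map_sum, ← sum_add_distrib]
      refine sum_congr rfl fun a ha => ?_
      rw [map_smul, evenJM_eigenvector hv hc ha (by omega), smul_smul, ← add_smul, completeSum]
      congr 1
      ring

theorem gramOp_eigenvector (hn : 0 < n) (hsum : ∑ a ∈ s, v a = stdVec n)
    (hv : ∀ a ∈ s, ∀ q, jucysMurphy q (v a) = a q • v a)
    (hc : ∀ a ∈ s, ∀ q : Fin (2 * n), (c a q : ℝ) = a q) (d : ℕ) :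
    ∀ a ∈ s, gramOp d n (v a) =
      (d * ∏ k ∈ Icc 1 (n - 1), ((d : ℝ) + c a (2 * k))) • v a := by
  intro a ha
  rw [← sub_eq_zero]
  refine eq_zero_of_sum_eigenvectors (s := s) (u := fun a => gramOp d n (v a) -
    (d * ∏ k ∈ Icc 1 (n - 1), ((d : ℝ) + c a (2 * k))) • v a) (fun a ha q => ?_) ?_ a ha
  · have h := LinearMap.congr_fun (commute_gramOp_jucysMurphy d q) (v a)
    simp only [Module.End.mul_apply] at h
    rw [map_sub, map_smul, ← h, hv a ha, map_smul, smul_sub, smul_comm (a q)]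
  · rw [sum_sub_distrib, ← map_sum, hsum, gramOp_stdVec hn,
      gramPartial_eq_sum hsum hv hc d _ (by omega), smul_sum, sub_eq_zero]
    simp only [smul_smul]

theorem exists_gramOp_eq_stdVec (hn : 0 < n) (hsum : ∑ a ∈ s, v a = stdVec n)
    (hv : ∀ a ∈ s, ∀ q, jucysMurphy q (v a) = a q • v a)
    (hc : ∀ a ∈ s, ∀ q : Fin (2 * n), (c a q : ℝ) = a q)
    (hd : ∀ a ∈ s, IsDoubled n (c a)) {d : ℕ} (hnd : n ≤ d) :
    gramOp d n (∑ a ∈ s, (d * ∏ k ∈ Icc 1 (n - 1), ((d : ℝ) + c a (2 * k)))⁻¹ • v a) =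
      stdVec n := by
  rw [map_sum, ← hsum]
  refine sum_congr rfl fun a ha => ?_
  rw [map_smul, gramOp_eigenvector hn hsum hv hc d a ha, smul_smul, inv_mul_cancel₀, one_smul]
  have hd0 : d ≠ 0 := by omega
  refine mul_ne_zero (by exact_mod_cast hd0) (prod_ne_zero_iff.2 fun k hk => ?_)
  have hk := mem_Icc.1 hk
  have h1 := (hd a ha).neg_le (k := k) (by omega)
  have h2 : ((d : ℤ) + c a (2 * k)) ≠ 0 := by omega
  exact_mod_cast h2

end Eigen

theorem isUnit_det_gramO {d : ℕ} {w : MatchingSpace (2 * n)} (hw : gramOp d n w = stdVec n) :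
    IsUnit (GramO d n).det := by
  choose σ hσ using fun p => exists_smul_eq (stdMatching n) p
  refine Matrix.isUnit_det_of_right_inverse
    (B := Matrix.of fun m p => matchingRep (σ p) w m) ?_
  ext q p
  have h := LinearMap.congr_fun (commute_gramOp_matchingRep d (σ p)) w
  simp only [Module.End.mul_apply] at h
  rw [hw, stdVec, matchingRep_single, hσ] at h
  have h := congrArg (fun f : MatchingSpace (2 * n) => f q) h
  simp only [PiLp.single_apply] at h
  rw [Matrix.mul_apply, Matrix.one_apply, ← h]
  rfl

theorem gramO_inv_apply_stdMatching {d : ℕ} {w : MatchingSpace (2 * n)}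
    (hw : gramOp d n w = stdVec n) (m : Matchings (2 * n)) :
    (GramO d n)⁻¹ m (stdMatching n) = w m := by
  have h1 : GramO d n *ᵥ w.ofLp = Pi.single (stdMatching n) 1 := by
    have := congrArg WithLp.ofLp hw
    exact this
  have h2 : (GramO d n)⁻¹ *ᵥ (GramO d n *ᵥ w.ofLp) = w.ofLp := by
    rw [mulVec_mulVec, nonsing_inv_mul _ (isUnit_det_gramO hw), one_mulVec]
  rw [h1, mulVec_single_one] at h2
  exact congrFun h2 m

theorem gramO_inv_smul (d : ℕ) (σ : Equiv.Perm (Fin (2 * n))) (m p : Matchings (2 * n)) :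
    (GramO d n)⁻¹ (σ • m) (σ • p) = (GramO d n)⁻¹ m p := by
  have h : (GramO d n).submatrix (MulAction.toPerm σ) (MulAction.toPerm σ) = GramO d n := by
    ext a b
    simp only [submatrix_apply, MulAction.toPerm_apply, GramO, loopCount_smul]
  conv_rhs => rw [← h, inv_submatrix_equiv]
  rfl

/-- The spectral form of the inverse Gram entries at a single loop. -/
theorem exists_spectral_formula (hn : 2 ≤ n) :
    ∃ (s : Finset (Fin (2 * n) → ℝ)) (c : (Fin (2 * n) → ℝ) → ℕ → ℤ)
      (μ : (Fin (2 * n) → ℝ) → ℝ), (∀ a ∈ s, IsDoubled n (c a)) ∧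
      (∀ j, ∑ a ∈ s, μ a * (∏ k ∈ Icc 1 (n - 1), (c a (2 * k) : ℝ)) *
        completeSum (fun i => c a (2 * (n - 1 - i))) (n - 1) j =
          homogeneousJM n (n - 1) j (stdMatching n)) ∧
      ∀ d : ℕ, n ≤ d → ∀ m p : Matchings (2 * n), loopCount m p = 1 →
        2 ^ (n - 1) * (n - 1).factorial * (GramO d n)⁻¹ m p =
          ∑ a ∈ s, μ a * (∏ k ∈ Icc 1 (n - 1), (c a (2 * k) : ℝ)) /
            (d * ∏ k ∈ Icc 1 (n - 1), ((d : ℝ) + c a (2 * k))) := by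
  obtain ⟨s, c, v, hsum, hv, hd, hc⟩ := exists_doubled_decomposition n
  refine ⟨s, c, fun a => v a (stdMatching n), hd, fun j => ?_, fun d hnd m p hmp => ?_⟩
  · rw [homogeneousJM_eq_sum (by omega) hsum hv hc]
    simp only [WithLp.ofLp_sum, Finset.sum_apply, WithLp.ofLp_smul, Pi.smul_apply, smul_eq_mul]
    exact sum_congr rfl fun a _ => by ring
  · have hw := exists_gramOp_eq_stdVec (by omega) hsum hv hc hd hnd
    set w := ∑ a ∈ s, (d * ∏ k ∈ Icc 1 (n - 1), ((d : ℝ) + c a (2 * k)))⁻¹ • v a with hwdef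
    have hinner : ∀ a ∈ s, ∑ q, gramPartial n 0 (n - 1) q * v a q =
        v a (stdMatching n) * ∏ k ∈ Icc 1 (n - 1), (c a (2 * k) : ℝ) := by
      intro a ha
      rw [mul_comm (v a _), ← inner_gramPartial_zero hv hc ha _ (by omega : n - 1 < n),
        PiLp.inner_apply]
      exact sum_congr rfl fun q _ => mul_comm _ _
    rw [← sum_gramPartial_zero (n := n) (n - 1) (by omega), sum_mul]
    have hF : ∀ q, gramPartial n 0 (n - 1) q * (GramO d n)⁻¹ m p =
        gramPartial n 0 (n - 1) q * w q := by
      intro q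
      by_cases hq : loopCount q (stdMatching n) = 1
      · obtain ⟨σ, h1, h2⟩ := exists_smul_eq_of_loopCount_eq_one hmp hq
        rw [← gramO_inv_smul d σ, h1, h2, gramO_inv_apply_stdMatching hw]
      · have := one_le_loopCount (by omega) q (stdMatching n)
        rw [gramPartial_last (by omega),
          zero_pow (show loopCount q (stdMatching n) - 1 ≠ 0 by omega), zero_mul, zero_mul]
    rw [sum_congr rfl fun q _ => hF q, hwdef]
    simp only [WithLp.ofLp_sum, Finset.sum_apply, WithLp.ofLp_smul, Pi.smul_apply, smul_eq_mul,
      mul_sum]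
    rw [sum_comm]
    refine sum_congr rfl fun a ha => ?_
    rw [← hinner a ha, sum_div]
    exact sum_congr rfl fun q _ => by ring

end GramInverse

section Asymptotics

open Finset Filter Topology

theorem tendsto_completeSum (x : ℕ → ℝ) (M : ℕ) : ∀ J : ℕ,
    Tendsto (fun t : ℝ => t ^ J * (∏ i ∈ range M, t / (t + x i) -
      ∑ j ∈ range J, (-1) ^ j * completeSum x M j * (t ^ j)⁻¹)) atTop
      (𝓝 ((-1) ^ J * completeSum x M J)) := by
  induction M with
  | zero =>
    rintro (_ | J)
    · simp [completeSum]
    · simp only [range_zero, prod_empty, sum_range_succ', completeSum]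
      simp
  | succ M ih =>
    intro J
    induction J with
    | zero =>
      have h : Tendsto (fun t : ℝ => t / (t + x M)) atTop (𝓝 1) := by
        have h1 : Tendsto (fun t : ℝ => 1 - x M / (t + x M)) atTop (𝓝 (1 - 0)) :=
          tendsto_const_nhds.sub
            (tendsto_const_nhds.div_atTop (tendsto_atTop_add_const_right _ _ tendsto_id))
        rw [sub_zero] at h1
        refine h1.congr' ?_
        filter_upwards [eventually_gt_atTop (-x M)] with t ht
        have : t + x M ≠ 0 := by linarith
        field_simp
        ring
      have h0 := (ih 0).mul h
      simpa only [pow_zero, one_mul, mul_one, range_zero, sum_empty, sub_zero, prod_range_succ,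
        completeSum] using h0
    | succ J ihJ =>
      have h := (ih (J + 1)).sub (ihJ.const_mul (x M))
      have hlim : (-1) ^ (J + 1) * completeSum x M (J + 1) -
          x M * ((-1) ^ J * completeSum x (M + 1) J) =
          (-1) ^ (J + 1) * completeSum x (M + 1) (J + 1) := by
        simp only [completeSum]
        ring
      rw [hlim] at h
      refine h.congr' ?_
      filter_upwards [eventually_gt_atTop (-x M), eventually_gt_atTop 0] with t ht ht0
      have h1 : t + x M ≠ 0 := by linarith
      have hf : ∏ i ∈ range (M + 1), t / (t + x i) = ∏ i ∈ range M, t / (t + x i) -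
          x M / t * ∏ i ∈ range (M + 1), t / (t + x i) := by
        rw [prod_range_succ]
        field_simp
        ring
      have hS : ∑ j ∈ range (J + 1), (-1) ^ j * completeSum x (M + 1) j * (t ^ j)⁻¹ =
          ∑ j ∈ range (J + 1), (-1) ^ j * completeSum x M j * (t ^ j)⁻¹ -
          x M / t * ∑ j ∈ range J, (-1) ^ j * completeSum x (M + 1) j * (t ^ j)⁻¹ := by
        rw [sum_range_succ', sum_range_succ', mul_sum, add_sub_right_comm, ← sum_sub_distrib]
        congr 1
        · refine sum_congr rfl fun j _ => ?_
          simp only [completeSum]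
          field_simp
          ring
        · simp only [completeSum]
      rw [hS]
      conv_rhs => rw [hf]
      rw [pow_succ]
      field_simp
      ring

theorem tendsto_prod_add_div_pow (s : Finset ℤ) :
    Tendsto (fun t : ℝ => (∏ y ∈ s, (t + (y : ℝ))) / t ^ #s) atTop (𝓝 1) := by
  have h : Tendsto (fun t : ℝ => ∏ y ∈ s, (1 + (y : ℝ) / t)) atTop (𝓝 (∏ y ∈ s, (1 + 0))) :=
    tendsto_finsetProd _ fun y _ =>
      tendsto_const_nhds.add (tendsto_const_nhds.div_atTop tendsto_id)
  simp only [add_zero, prod_const_one] at h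
  refine h.congr' ?_
  filter_upwards [eventually_gt_atTop 0] with t ht
  rw [← prod_const, ← prod_div_distrib]
  refine prod_congr rfl fun y _ => ?_
  field_simp

open Polynomial in
/-- A polynomial whose values along the naturals grow like `c t ^ k`. -/
theorem natDegree_eq_and_leadingCoeff_eq {P : ℚ[X]} {k : ℕ} {c : ℚ} (hc : c ≠ 0)
    (h : Tendsto (fun d : ℕ => ((P.eval (d : ℚ) : ℚ) : ℝ) / (d : ℝ) ^ k) atTop (𝓝 (c : ℝ))) :
    P.natDegree = k ∧ P.leadingCoeff = c := by
  have hX : (X ^ k : ℚ[X]) ≠ 0 := pow_ne_zero _ X_ne_zero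
  have hq : Tendsto (fun d : ℕ => P.eval (d : ℚ) / (X ^ k : ℚ[X]).eval (d : ℚ)) atTop (𝓝 c) := by
    rw [Rat.isUniformEmbedding_coe_real.isEmbedding.tendsto_nhds_iff]
    refine h.congr fun d => ?_
    simp
  have hcast : Tendsto (fun d : ℕ => (d : ℚ)) atTop atTop := tendsto_natCast_atTop_atTop
  rcases lt_trichotomy P.degree (X ^ k : ℚ[X]).degree with hlt | heq | hgt
  · exact (hc (tendsto_nhds_unique hq
      ((div_tendsto_atTop_zero_of_degree_lt P _ hlt).comp hcast))).elim
  · have h1 := tendsto_nhds_unique hq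
      ((div_tendsto_atTop_leadingCoeff_div_of_degree_eq P _ heq).comp hcast)
    rw [leadingCoeff_X_pow, div_one] at h1
    refine ⟨?_, h1.symm⟩
    rw [natDegree_eq_of_degree_eq heq, natDegree_X_pow]
  · have h1 := (abs_div_tendsto_atTop_atTop_of_degree_gt P _ hgt hX).comp hcast
    exact (not_tendsto_nhds_of_tendsto_atTop h1 _ hq.abs).elim

open Polynomial in
theorem exists_rat_polynomial (p : ℝ[X]) : ∃ P : ℚ[X], ∀ (d : ℕ) (q : ℚ),
    p.eval (d : ℝ) = q → P.eval (d : ℚ) = q := by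
  obtain ⟨π, hπ⟩ := LinearMap.exists_leftInverse_of_injective (Algebra.linearMap ℚ ℝ)
    (LinearMap.ker_eq_bot.2 (algebraMap ℚ ℝ).injective)
  refine ⟨∑ i ∈ range (p.natDegree + 1), monomial i (π (p.coeff i)), fun d q h => ?_⟩
  have hq : π (q : ℝ) = q := LinearMap.congr_fun hπ q
  rw [← hq, ← h, eval_eq_sum_range (p := p), map_sum, eval_finsetSum]
  refine sum_congr rfl fun i _ => ?_
  rw [eval_monomial, mul_comm, mul_comm (p.coeff i), ← smul_eq_mul, ← map_smul, Rat.smul_def]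
  push_cast
  rfl

end Asymptotics

section Main

open Finset Filter Topology

variable {n : ℕ}

theorem exists_rat_gramO_inv (d : ℕ) (m p : Matchings (2 * n)) :
    ∃ q : ℚ, (GramO d n)⁻¹ m p = q := by
  let A : Matrix (Matchings (2 * n)) (Matchings (2 * n)) ℚ := fun m p => (d : ℚ) ^ loopCount m p
  have hA : GramO d n = (algebraMap ℚ ℝ).mapMatrix A := by
    ext m p
    rw [RingHom.mapMatrix_apply, Matrix.map_apply]
    simp [A, GramO]
  refine ⟨A⁻¹ m p, ?_⟩
  rw [hA, Matrix.inv_def, Matrix.inv_def, ← RingHom.map_det, ← RingHom.map_adjugate]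
  simp [Matrix.smul_apply, Ring.inverse_eq_inv']

theorem exists_loopCount_eq_one (hn : 0 < n) : ∃ m p : Matchings (2 * n), loopCount m p = 1 := by
  have h : ∑ m, gramPartial n 0 (n - 1) m ≠ 0 := by
    rw [sum_gramPartial_zero _ (by omega)]
    positivity
  obtain ⟨m, -, hm⟩ := exists_ne_zero_of_sum_ne_zero h
  refine ⟨m, stdMatching n, ?_⟩
  rw [gramPartial_last hn] at hm
  have h1 := one_le_loopCount (by omega) m (stdMatching n)
  by_contra h2
  exact hm (zero_pow (by omega))

end Main

open Finset Filter Topology in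
theorem stmt16 (n : ℕ) (hn : 2 ≤ n) :
    ∃ P : Polynomial ℚ,
      P.natDegree = n / 2 - 1 ∧
      P.leadingCoeff = (catalan (n - 1) : ℚ) ∧
      ∀ d : ℕ, d ≥ n → ∀ m p : Matchings (2*n), loopCount m p = 1 →
        (GramO d n)⁻¹ m p =
          (-1 : ℝ) ^ (n - 1) * ((P.eval (d : ℚ) : ℚ) : ℝ) /
            ((d : ℝ) * (∏ j ∈ Finset.Icc 1 (n-1), ((d : ℝ) + 2*j) * ((d : ℝ) - j)) *
              ∏ k ∈ Finset.Icc 1 (n/2 - 1), ((d : ℝ) + 2*k - 1)) := by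
  obtain ⟨s, c, μ, hdbl, hH, hF⟩ := exists_spectral_formula hn
  have hIcc : Icc 1 (n - 1) = Ico 1 n := by
    ext k
    rw [mem_Icc, mem_Ico]
    omega
  set w : (Fin (2 * n) → ℝ) → ℝ := fun a => μ a * ∏ k ∈ Icc 1 (n - 1), (c a (2 * k) : ℝ) with hw
  set B : ℝ := 2 ^ (n - 1) * (n - 1).factorial with hB
  have hB0 : B ≠ 0 := by positivity
  set Q : Polynomial ℝ := Polynomial.C ((-1) ^ (n - 1) / B) * ∑ a ∈ s, Polynomial.C (w a) *
    ∏ y ∈ poleSet n \ (Ico 1 n).image (fun k => c a (2 * k)), (Polynomial.X + Polynomial.C (y : ℝ))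
    with hQ
  have hpole : ∀ d : ℕ, n ≤ d → (d : ℝ) * (∏ j ∈ Icc 1 (n-1), ((d : ℝ) + 2*j) * ((d : ℝ) - j)) *
      ∏ k ∈ Icc 1 (n/2 - 1), ((d : ℝ) + 2*k - 1) ≠ 0 := by
    intro d hd
    have hd' : (n : ℝ) ≤ d := by exact_mod_cast hd
    have h0 : (0 : ℝ) < d := by
      have : 0 < d := by omega
      exact_mod_cast this
    refine (mul_pos (mul_pos h0 (prod_pos fun j hj => ?_)) (prod_pos fun k hk => ?_)).ne'
    · have h2 : (j : ℝ) + 1 ≤ n := by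
        have := mem_Icc.1 hj
        exact_mod_cast (by omega : j + 1 ≤ n)
      exact mul_pos (by positivity) (by linarith)
    · have h2 : (1 : ℝ) ≤ k := by exact_mod_cast (mem_Icc.1 hk).1
      linarith
  have hEval : ∀ d : ℕ, n ≤ d → Q.eval (d : ℝ) = (-1) ^ (n - 1) / B *
      ((∑ a ∈ s, w a / (d * ∏ k ∈ Icc 1 (n - 1), ((d : ℝ) + c a (2 * k)))) *
        (d * ∏ y ∈ poleSet n, ((d : ℝ) + (y : ℝ)))) := by
    intro d hd
    rw [hQ, Polynomial.eval_mul, Polynomial.eval_C, Polynomial.eval_finsetSum, sum_mul]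
    congr 1
    refine sum_congr rfl fun a ha => ?_
    rw [Polynomial.eval_mul, Polynomial.eval_C, Polynomial.eval_prod]
    simp only [Polynomial.eval_add, Polynomial.eval_X, Polynomial.eval_C]
    by_cases h0 : ∀ k, 0 < k → k < n → c a (2 * k) ≠ 0
    · rw [← (hdbl a ha).prod_sdiff h0 (d : ℝ), hIcc]
      have h1 : (d : ℝ) ≠ 0 := by
        have : d ≠ 0 := by omega
        exact_mod_cast this
      have h2 : ∏ k ∈ Ico 1 n, ((d : ℝ) + c a (2 * k)) ≠ 0 := by
        refine prod_ne_zero_iff.2 fun k hk => ?_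
        have hk := mem_Ico.1 hk
        have h1 := (hdbl a ha).neg_le (k := k) (by omega)
        have h2 : ((d : ℤ) + c a (2 * k)) ≠ 0 := by omega
        exact_mod_cast h2
      field_simp
    · push Not at h0
      obtain ⟨k, hk0, hkn, hk⟩ := h0
      have : w a = 0 := by
        rw [hw]
        refine mul_eq_zero_of_right _ (prod_eq_zero (i := k) (mem_Icc.2 ⟨hk0, by omega⟩) ?_)
        rw [hk, Int.cast_zero]
      rw [this]
      simp
  have hval : ∀ d : ℕ, n ≤ d → ∀ m p : Matchings (2 * n), loopCount m p = 1 →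
      (GramO d n)⁻¹ m p = (-1 : ℝ) ^ (n - 1) * Q.eval (d : ℝ) /
        ((d : ℝ) * (∏ j ∈ Icc 1 (n-1), ((d : ℝ) + 2*j) * ((d : ℝ) - j)) *
          ∏ k ∈ Icc 1 (n/2 - 1), ((d : ℝ) + 2*k - 1)) := by
    intro d hd m p hmp
    rw [eq_div_iff (hpole d hd), hEval d hd, ← hF d hd m p hmp, prod_poleSet]
    have hs : (-1 : ℝ) ^ (n - 1) * (-1) ^ (n - 1) = 1 := by
      rw [← mul_pow]
      simp
    generalize (GramO d n)⁻¹ m p = F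
    calc F * _ = ((-1) ^ (n - 1) * (-1) ^ (n - 1)) * (B / B) * (F * _) := by
          rw [hs, div_self hB0, one_mul, one_mul]
      _ = _ := by ring
  obtain ⟨P, hP⟩ := exists_rat_polynomial Q
  have hPQ : ∀ d : ℕ, n ≤ d → ((P.eval (d : ℚ) : ℚ) : ℝ) = Q.eval (d : ℝ) := by
    intro d hd
    obtain ⟨m, p, hmp⟩ := exists_loopCount_eq_one (n := n) (by omega)
    obtain ⟨q, hq⟩ := exists_rat_gramO_inv d m p
    have h := hval d hd m p hmp
    rw [hq, eq_div_iff (hpole d hd)] at h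
    have hs : (-1 : ℝ) ^ (n - 1) * (-1) ^ (n - 1) = 1 := by
      rw [← mul_pow]
      simp
    have h' : Q.eval (d : ℝ) = (((-1) ^ (n - 1) * (q * ((d : ℚ) *
        (∏ j ∈ Icc 1 (n-1), ((d : ℚ) + 2*j) * ((d : ℚ) - j)) *
          ∏ k ∈ Icc 1 (n/2 - 1), ((d : ℚ) + 2*k - 1))) : ℚ) : ℝ) := by
      push_cast
      rw [h, ← mul_assoc, hs, one_mul]
    rw [hP d _ h', h']
  have hG : Tendsto (fun t : ℝ => t ^ (n - 1) *
      ∑ a ∈ s, w a * ∏ k ∈ Icc 1 (n - 1), t / (t + c a (2 * k))) atTop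
      (𝓝 ((-1) ^ (n - 1) * (B * catalan (n - 1)))) := by
    have h := tendsto_finsetSum s fun a _ =>
      (tendsto_completeSum (fun i => c a (2 * (n - 1 - i))) (n - 1) (n - 1)).const_mul (w a)
    have hl : ∑ a ∈ s, w a * ((-1) ^ (n - 1) *
        completeSum (fun i => c a (2 * (n - 1 - i))) (n - 1) (n - 1)) =
        (-1) ^ (n - 1) * (B * catalan (n - 1)) := by
      rw [hB, ← homogeneousJM_stdMatching hn, ← hH, mul_sum]
      exact sum_congr rfl fun a _ => by rw [hw]; ring
    rw [hl] at h
    refine h.congr fun t => ?_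
    have hz : ∑ a ∈ s, w a * ∑ j ∈ range (n - 1), (-1) ^ j *
        completeSum (fun i => c a (2 * (n - 1 - i))) (n - 1) j * (t ^ j)⁻¹ = 0 := by
      simp only [mul_sum]
      rw [sum_comm]
      refine sum_eq_zero fun j hj => ?_
      calc _ = (-1) ^ j * (t ^ j)⁻¹ * ∑ a ∈ s, w a *
            completeSum (fun i => c a (2 * (n - 1 - i))) (n - 1) j := by
            rw [mul_sum]
            exact sum_congr rfl fun a _ => by ring
        _ = 0 := by
            rw [hw, hH, homogeneousJM_stdMatching_of_lt (mem_range.1 hj), mul_zero]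
    have hr : ∀ a, ∏ i ∈ range (n - 1), t / (t + c a (2 * (n - 1 - i))) =
        ∏ k ∈ Icc 1 (n - 1), t / (t + c a (2 * k)) := fun a => by
      refine prod_nbij' (fun i => n - 1 - i) (fun k => n - 1 - k) ?_ ?_ ?_ ?_ fun _ _ => rfl <;>
      · intro i hi
        simp only [mem_range, mem_Icc] at hi ⊢
        omega
    calc _ = t ^ (n - 1) * (∑ a ∈ s, w a * ∏ i ∈ range (n - 1), t / (t + c a (2 * (n - 1 - i))) -
          ∑ a ∈ s, w a * ∑ j ∈ range (n - 1), (-1) ^ j *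
            completeSum (fun i => c a (2 * (n - 1 - i))) (n - 1) j * (t ^ j)⁻¹) := by
          rw [← sum_sub_distrib, mul_sum]
          exact sum_congr rfl fun a _ => by ring
      _ = _ := by
          rw [hz, sub_zero]
          simp only [hr]
  have hlim : Tendsto (fun d : ℕ => ((P.eval (d : ℚ) : ℚ) : ℝ) / (d : ℝ) ^ (n / 2 - 1)) atTop
      (𝓝 ((catalan (n - 1) : ℚ) : ℝ)) := by
    have h := ((hG.mul (tendsto_prod_add_div_pow (poleSet n))).const_mul
      ((-1) ^ (n - 1) / B)).comp tendsto_natCast_atTop_atTop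
    have hval : (-1) ^ (n - 1) / B * ((-1) ^ (n - 1) * (B * catalan (n - 1)) * 1) =
        ((catalan (n - 1) : ℚ) : ℝ) := by
      have hs : (-1 : ℝ) ^ (n - 1) * (-1) ^ (n - 1) = 1 := by
        rw [← mul_pow]
        simp
      calc _ = ((-1 : ℝ) ^ (n - 1) * (-1) ^ (n - 1)) * (B / B) * catalan (n - 1) := by ring
        _ = _ := by rw [hs, div_self hB0, one_mul, one_mul, Rat.cast_natCast]
    rw [hval] at h
    refine h.congr' ?_
    filter_upwards [eventually_ge_atTop n] with d hd
    have hd0 : (d : ℝ) ≠ 0 := by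
      have : d ≠ 0 := by omega
      exact_mod_cast this
    have hsum : ∑ a ∈ s, w a * ∏ k ∈ Icc 1 (n - 1), (d : ℝ) / (d + c a (2 * k)) =
        (d : ℝ) ^ (n - 1) * d *
          ∑ a ∈ s, w a / (d * ∏ k ∈ Icc 1 (n - 1), ((d : ℝ) + c a (2 * k))) := by
      rw [mul_sum]
      refine sum_congr rfl fun a _ => ?_
      rw [prod_div_distrib, prod_const, Nat.card_Icc, Nat.add_sub_cancel, ← div_div]
      field_simp
    rw [Function.comp_apply, hPQ d hd, hEval d hd, hsum, card_poleSet, pow_add, pow_add]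
    field_simp
  have hcat : (catalan (n - 1) : ℚ) ≠ 0 := by
    intro h
    have h1 := succ_mul_catalan_eq_centralBinom (n - 1)
    rw [Nat.cast_eq_zero.1 h, mul_zero] at h1
    exact (Nat.centralBinom_ne_zero _ h1.symm).elim
  obtain ⟨h1, h2⟩ := natDegree_eq_and_leadingCoeff_eq hcat hlim
  refine ⟨P, h1, h2, fun d hd m p hmp => ?_⟩
  rw [hPQ d hd]
  exact hval d hd m p hmp
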